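/- arXiv:1402.1092 — 2 statements merged into one kernel-verified Lean document; each statement's English description precedes it below -/
import Mathlib

section
/- (Olevskii) Let 0 < δ < 1. There exists an orthonormal system {ψ_n}_{n∈ℕ} of real-valued functions in L²[0,1] which is closed in C[0,1] (i.e., finite linear combinations of the ψ_n are uniformly dense in C[0,1]), such that sup_{n∈ℕ} ‖ψ_n‖_{L^∞[0,1]} < ∞, and such that there exists a constant C₇ with ∫_{0}^{1} | Σ_{n=1}^{N} ψ_n(x) ψ_n(τ) | dτ ≤ C₇ for all x ∈ [δ,1] and all N ∈ ℕ. -/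
open MeasureTheory Filter Finset

/-- Sylvester-Hadamard matrices -/
noncomputable def Hd : ℕ → ℕ → ℕ → ℝ
  | 0, _, _ => 1
  | K+1, i, w => (if i < 2^K ∨ w < 2^K then 1 else -1) * Hd K (i % 2^K) (w % 2^K)

lemma Hd_ll {K i w : ℕ} (hi : i < 2^K) (hw : w < 2^K) : Hd (K+1) i w = Hd K i w := by
  simp [Hd, hi, Nat.mod_eq_of_lt hi, Nat.mod_eq_of_lt hw]

lemma Hd_lr {K i w : ℕ} (hi : i < 2^K) (hw : w < 2^K) : Hd (K+1) i (2^K + w) = Hd K i w := by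
  simp [Hd, hi, Nat.mod_eq_of_lt hi, Nat.mod_eq_of_lt hw]

lemma Hd_rl {K i w : ℕ} (hi : i < 2^K) (hw : w < 2^K) : Hd (K+1) (2^K + i) w = Hd K i w := by
  simp [Hd, hw, Nat.mod_eq_of_lt hi, Nat.mod_eq_of_lt hw]

lemma Hd_rr {K i w : ℕ} (hi : i < 2^K) (hw : w < 2^K) :
    Hd (K+1) (2^K + i) (2^K + w) = - Hd K i w := by
  simp [Hd, Nat.mod_eq_of_lt hi, Nat.mod_eq_of_lt hw]

lemma Hd_abs (K i w : ℕ) : |Hd K i w| = 1 := by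
  induction K generalizing i w with
  | zero => simp [Hd]
  | succ K ih =>
    rw [Hd, abs_mul, ih]
    split_ifs <;> simp

lemma Hd_zero (K i : ℕ) : Hd K i 0 = 1 := by
  induction K generalizing i with
  | zero => simp [Hd]
  | succ K ih => simp [Hd, ih]

lemma sum_two (K : ℕ) (F : ℕ → ℝ) : ∑ w ∈ range (2^(K+1)), F w =
    ∑ w ∈ range (2^K), F w + ∑ w ∈ range (2^K), F (2^K + w) := by
  rw [pow_succ, mul_two, Finset.sum_range_add]

lemma lt_cases {K i : ℕ} (h : i < 2^(K+1)) : i < 2^K ∨ ∃ j, j < 2^K ∧ i = 2^K + j := by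
  rw [pow_succ] at h
  by_cases h' : i < 2^K
  · exact Or.inl h'
  · exact Or.inr ⟨i - 2^K, by omega, by omega⟩

lemma Hd_orth (K : ℕ) : ∀ i < 2^K, ∀ j < 2^K,
    ∑ w ∈ range (2^K), Hd K i w * Hd K j w = if i = j then (2:ℝ)^K else 0 := by
  induction K with
  | zero => intro i hi j hj; simp at hi hj; simp [hi, hj, Hd]
  | succ K ih =>
    intro i hI j hJ
    rw [sum_two]
    rcases lt_cases hI with hi | ⟨i, hi, rfl⟩ <;> rcases lt_cases hJ with hj | ⟨j, hj, rfl⟩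
    · rw [Finset.sum_congr rfl (g := fun w => Hd K i w * Hd K j w),
        Finset.sum_congr rfl (g := fun w => Hd K i w * Hd K j w) (s₁ := range (2^K)) (f := fun w => Hd (K+1) i (2^K + w) * _), ih i hi j hj]
      · split_ifs <;> ring
      · intro w hw; rw [Hd_lr hi (by simpa using hw), Hd_lr hj (by simpa using hw)]
      · intro w hw; rw [Hd_ll hi (by simpa using hw), Hd_ll hj (by simpa using hw)]
    · rw [Finset.sum_congr rfl (g := fun w => Hd K i w * Hd K j w),
        Finset.sum_congr rfl (g := fun w => - (Hd K i w * Hd K j w)) (s₁ := range (2^K)) (f := fun w => Hd (K+1) i (2^K + w) * _), Finset.sum_neg_distrib, add_neg_cancel, if_neg (by omega)]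
      · intro w hw; rw [Hd_lr hi (by simpa using hw), Hd_rr hj (by simpa using hw)]; ring
      · intro w hw; rw [Hd_ll hi (by simpa using hw), Hd_rl hj (by simpa using hw)]
    · rw [Finset.sum_congr rfl (g := fun w => Hd K i w * Hd K j w),
        Finset.sum_congr rfl (g := fun w => - (Hd K i w * Hd K j w)) (s₁ := range (2^K)) (f := fun w => Hd (K+1) _ (2^K + w) * _), Finset.sum_neg_distrib, add_neg_cancel, if_neg (by omega)]
      · intro w hw; rw [Hd_rr hi (by simpa using hw), Hd_lr hj (by simpa using hw)]; ring
      · intro w hw; rw [Hd_rl hi (by simpa using hw), Hd_ll hj (by simpa using hw)]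
    · rw [Finset.sum_congr rfl (g := fun w => Hd K i w * Hd K j w),
        Finset.sum_congr rfl (g := fun w => Hd K i w * Hd K j w) (s₁ := range (2^K)) (f := fun w => Hd (K+1) _ (2^K + w) * _), ih i hi j hj]
      · simp only [Nat.add_left_cancel_iff]; split_ifs <;> ring
      · intro w hw; rw [Hd_rr hi (by simpa using hw), Hd_rr hj (by simpa using hw)]; ring
      · intro w hw; rw [Hd_rl hi (by simpa using hw), Hd_rl hj (by simpa using hw)]

lemma Hd_colsum (K : ℕ) : ∀ w < 2^K,
    ∑ i ∈ range (2^K), Hd K i w = if w = 0 then (2:ℝ)^K else 0 := by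
  induction K with
  | zero => intro w hw; simp at hw; simp [hw, Hd]
  | succ K ih =>
    intro w hW
    rw [sum_two]
    rcases lt_cases hW with hw | ⟨w, hw, rfl⟩
    · rw [Finset.sum_congr rfl (g := fun i => Hd K i w),
        Finset.sum_congr rfl (g := fun i => Hd K i w) (s₁ := range (2^K)) (f := fun i => Hd (K+1) (2^K + i) w), ih w hw]
      · split_ifs <;> ring
      · intro i hi; exact Hd_rl (by simpa using hi) hw
      · intro i hi; exact Hd_ll (by simpa using hi) hw
    · rw [Finset.sum_congr rfl (g := fun i => Hd K i w),
        Finset.sum_congr rfl (g := fun i => - Hd K i w) (s₁ := range (2^K)) (f := fun i => Hd (K+1) (2^K + i) (2^K + w)), Finset.sum_neg_distrib, add_neg_cancel, if_neg (by have := Nat.two_pow_pos K; omega)]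
      · intro i hi; exact Hd_rr (by simpa using hi) hw
      · intro i hi; exact Hd_lr (by simpa using hi) hw

lemma Hd_leb (K : ℕ) : ∀ m ≤ 2^K,
    ∑ w ∈ range (2^K), |∑ i ∈ range m, Hd K i w| ≤ (K+1) * 2^K := by
  induction K with
  | zero =>
    intro m hm
    simp at hm
    interval_cases m <;> simp [Hd]
  | succ K ih =>
    intro m hm
    rw [sum_two]
    by_cases h : m ≤ 2^K
    · rw [Finset.sum_congr rfl (g := fun w => |∑ i ∈ range m, Hd K i w|),
        Finset.sum_congr rfl (g := fun w => |∑ i ∈ range m, Hd K i w|) (s₁ := range (2^K)) (f := fun w => |∑ i ∈ range m, Hd (K+1) i (2^K + w)|)]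
      · have := ih m h
        push_cast; rw [pow_succ]; have h2 : (0:ℝ) < 2^K := by positivity
        nlinarith
      · intro w hw
        congr 1
        exact Finset.sum_congr rfl fun i hi => Hd_lr (by simp at hi; omega) (by simpa using hw)
      · intro w hw
        congr 1
        exact Finset.sum_congr rfl fun i hi => Hd_ll (by simp at hi; omega) (by simpa using hw)
    · obtain ⟨m, rfl⟩ : ∃ j, m = 2^K + j := ⟨m - 2^K, by omega⟩
      have hm' : m ≤ 2^K := by rw [pow_succ] at hm; omega
      have key : ∀ w ∈ range (2^K), |∑ i ∈ range (2^K + m), Hd (K+1) i w| ≤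
          (if w = 0 then (2:ℝ)^K else 0) + |∑ i ∈ range m, Hd K i w| := by
        intro w hw
        have hw : w < 2^K := by simpa using hw
        rw [Finset.sum_range_add, Finset.sum_congr rfl (g := fun i => Hd K i w),
          Finset.sum_congr rfl (g := fun i => Hd K i w) (s₁ := range m), Hd_colsum K w hw]
        · refine (abs_add_le _ _).trans ?_
          gcongr
          rw [abs_of_nonneg]
          split_ifs <;> positivity
        · intro i hi; exact Hd_rl (by simp at hi; omega) hw
        · intro i hi; exact Hd_ll (by simpa using hi) hw
      have key2 : ∀ w ∈ range (2^K), |∑ i ∈ range (2^K + m), Hd (K+1) i (2^K + w)| ≤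
          (if w = 0 then (2:ℝ)^K else 0) + |∑ i ∈ range m, Hd K i w| := by
        intro w hw
        have hw : w < 2^K := by simpa using hw
        rw [Finset.sum_range_add, Finset.sum_congr rfl (g := fun i => Hd K i w),
          Finset.sum_congr rfl (g := fun i => - Hd K i w) (s₁ := range m), Hd_colsum K w hw, Finset.sum_neg_distrib]
        · refine (abs_add_le _ _).trans ?_
          rw [abs_neg]
          gcongr
          rw [abs_of_nonneg]
          split_ifs <;> positivity
        · intro i hi; exact Hd_rr (by simp at hi; omega) hw
        · intro i hi; exact Hd_lr (by simpa using hi) hw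
      have h1 := Finset.sum_le_sum key
      have h2 := Finset.sum_le_sum key2
      have h3 := ih m hm'
      rw [Finset.sum_add_distrib, Finset.sum_ite_eq' (range (2^K)) 0 (fun _ => (2:ℝ)^K), if_pos (by simp)] at h1 h2
      push_cast; rw [pow_succ]; have h2' : (0:ℝ) < 2^K := by positivity
      nlinarith

/-- the building functions, as step functions with `2 * 2^K` cells -/
noncomputable def vv (K i c : ℕ) : ℝ :=
  (if c < 2^K then 1 else -1) * (if c % 2^K = 0 then 0 else Hd K i (c % 2^K))

lemma sum_vv (K : ℕ) (F : ℕ → ℝ) : ∑ c ∈ range (2 * 2^K), F c =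
    ∑ c ∈ range (2^K), (F c + F (2^K + c)) := by
  rw [two_mul, Finset.sum_range_add, Finset.sum_add_distrib]

lemma vv_l {K i c : ℕ} (hc : c < 2^K) : vv K i c = if c = 0 then 0 else Hd K i c := by
  simp [vv, hc, Nat.mod_eq_of_lt hc]

lemma vv_r {K i c : ℕ} (hc : c < 2^K) : vv K i (2^K + c) = - if c = 0 then 0 else Hd K i c := by
  simp only [vv, Nat.add_mod_left, Nat.mod_eq_of_lt hc]
  rw [if_neg (by omega)]; ring

lemma vv_abs (K i c : ℕ) : |vv K i c| ≤ 1 := by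
  rw [vv, abs_mul]
  have := Hd_abs K i (c % 2^K)
  split_ifs <;> simp [*]

lemma vv_mean (K i : ℕ) : ∑ c ∈ range (2 * 2^K), vv K i c = 0 := by
  rw [sum_vv]
  refine Finset.sum_eq_zero fun c hc => ?_
  rw [vv_l (by simpa using hc), vv_r (by simpa using hc)]; ring

lemma vv_orth (K : ℕ) : ∀ i < 2^K, ∀ j < 2^K,
    ∑ c ∈ range (2 * 2^K), vv K i c * vv K j c = 2 * ((if i = j then (2:ℝ)^K else 0) - 1) := by
  intro i hi j hj
  rw [sum_vv, ← Hd_orth K i hi j hj]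
  have : ∀ c ∈ range (2^K), vv K i c * vv K j c + vv K i (2^K + c) * vv K j (2^K + c) =
      2 * (Hd K i c * Hd K j c - if c = 0 then 1 else 0) := by
    intro c hc
    have hc : c < 2^K := by simpa using hc
    rw [vv_l hc, vv_l hc, vv_r hc, vv_r hc]
    by_cases h : c = 0
    · simp [h, Hd_zero]
    · simp [h]; ring
  rw [Finset.sum_congr rfl this, ← Finset.mul_sum, Finset.sum_sub_distrib,
    Finset.sum_ite_eq' (range (2^K)) 0 (fun _ => (1:ℝ)), if_pos (by simp)]

lemma vv_colsum (K c : ℕ) : ∑ i ∈ range (2^K), vv K i c = 0 := by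
  unfold vv
  rw [← Finset.mul_sum]
  by_cases h : c % 2^K = 0
  · simp [h]
  · simp only [h, if_false]
    rw [Hd_colsum K _ (Nat.mod_lt _ (by positivity)), if_neg h, mul_zero]

lemma vv_leb (K : ℕ) : ∀ m ≤ 2^K,
    ∑ c ∈ range (2 * 2^K), |∑ i ∈ range m, vv K i c| ≤ (K+1) * (2 * 2^K) := by
  intro m hm
  rw [sum_vv]
  have h := Hd_leb K m hm
  have : ∀ c ∈ range (2^K), |∑ i ∈ range m, vv K i c| + |∑ i ∈ range m, vv K i (2^K + c)| ≤
      2 * |∑ i ∈ range m, Hd K i c| := by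
    intro c hc
    have hc : c < 2^K := by simpa using hc
    simp only [vv_l hc, vv_r hc]
    by_cases h : c = 0
    · simp [h]
    · simp only [h, if_false, Finset.sum_neg_distrib, abs_neg]; linarith
  have h2 := Finset.sum_le_sum this
  rw [← Finset.mul_sum] at h2
  linarith

lemma sum_divmod (N Q : ℕ) (hQ : 0 < Q) (F : ℕ → ℕ → ℝ) :
    ∑ k ∈ range (N * Q), F (k / Q) (k % Q) = ∑ a ∈ range N, ∑ r ∈ range Q, F a r := by
  induction N with
  | zero => simp
  | succ N ih =>
    rw [Nat.succ_mul, Finset.sum_range_add, ih, Finset.sum_range_succ]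
    congr 1
    refine Finset.sum_congr rfl fun r hr => ?_
    have hr : r < Q := by simpa using hr
    rw [mul_comm N Q, Nat.mul_add_div hQ, Nat.mul_add_mod, Nat.div_eq_of_lt hr, Nat.mod_eq_of_lt hr, add_zero]

/-- uniform step function on `[0,δ)` -/
noncomputable def TT (δ : ℝ) (N : ℕ) (c : ℕ → ℝ) : ℝ → ℝ :=
  (Set.Ico 0 δ).indicator (fun x => c ⌊N * x / δ⌋₊)

lemma TT_meas (δ : ℝ) (N : ℕ) (c : ℕ → ℝ) : Measurable (TT δ N c) := by
  refine Measurable.indicator ?_ measurableSet_Ico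
  have h : Measurable (fun x : ℝ => ⌊N * x / δ⌋₊) :=
    Nat.measurable_floor.comp (by fun_prop)
  exact (measurable_from_nat (f := c)).comp h

lemma TT_in {δ : ℝ} {N : ℕ} {c : ℕ → ℝ} {x : ℝ} (hx : x ∈ Set.Ico 0 δ) :
    TT δ N c x = c ⌊N * x / δ⌋₊ := by simp only [TT, Set.indicator_of_mem hx]

lemma TT_out {δ : ℝ} {N : ℕ} {c : ℕ → ℝ} {x : ℝ} (hx : x ∉ Set.Ico 0 δ) :
    TT δ N c x = 0 := by simp only [TT, Set.indicator_of_notMem hx]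

lemma TT_ext {δ : ℝ} {N : ℕ} {c : ℕ → ℝ} {f : ℝ → ℝ} (h1 : ∀ x ∈ Set.Ico 0 δ, f x = c ⌊N * x / δ⌋₊)
    (h2 : ∀ x, x ∉ Set.Ico 0 δ → f x = 0) : f = TT δ N c := by
  ext x
  by_cases hx : x ∈ Set.Ico 0 δ
  · rw [TT_in hx, h1 x hx]
  · rw [TT_out hx, h2 x hx]

lemma TT_floor_lt {δ : ℝ} (hδ : 0 < δ) {N : ℕ} (hN : 0 < N) {x : ℝ} (hx : x ∈ Set.Ico 0 δ) :
    ⌊N * x / δ⌋₊ < N := by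
  have hN' : (0:ℝ) < N := by exact_mod_cast hN
  rw [Nat.floor_lt (by have := hx.1; positivity), div_lt_iff₀ hδ]
  exact mul_lt_mul_of_pos_left hx.2 hN'

lemma TT_int {δ : ℝ} (hδ : 0 < δ) (hδ1 : δ < 1) {N : ℕ} (hN : 0 < N) (c : ℕ → ℝ) :
    ∫ x in Set.Icc (0:ℝ) 1, TT δ N c x = δ / N * ∑ k ∈ range N, c k := by
  have hN' : (0:ℝ) < N := by exact_mod_cast hN
  have h : TT δ N c = fun x => ∑ k ∈ range N, (Set.Ico (k * δ / N) ((k+1) * δ / N)).indicator (fun _ => c k) x := by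
    ext x
    by_cases hx : x ∈ Set.Ico 0 δ
    · rw [TT_in hx, Finset.sum_eq_single ⌊N * x / δ⌋₊]
      · rw [Set.indicator_of_mem]
        have h0 : 0 ≤ N * x / δ := by have := hx.1; positivity
        have h1 := Nat.floor_le h0
        have h2 := Nat.lt_floor_add_one (N * x / δ)
        constructor
        · rw [div_le_iff₀ hN']; rw [le_div_iff₀ hδ] at h1; linarith
        · rw [lt_div_iff₀ hN']; rw [div_lt_iff₀ hδ] at h2; linarith
      · intro k _ hk
        refine Set.indicator_of_notMem (fun hm => hk ?_) _
        symm
        rw [Nat.floor_eq_iff (by have := hx.1; positivity)]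
        obtain ⟨h1, h2⟩ := hm
        rw [div_le_iff₀ hN'] at h1
        rw [lt_div_iff₀ hN'] at h2
        constructor
        · rw [le_div_iff₀ hδ]; linarith
        · rw [div_lt_iff₀ hδ]; linarith
      · intro h; exact absurd (by simpa using TT_floor_lt hδ hN hx) h
    · rw [TT_out hx]
      symm
      refine Finset.sum_eq_zero fun k hk => Set.indicator_of_notMem (fun hm => hx ?_) _
      have hk : (k:ℝ) + 1 ≤ N := by exact_mod_cast (by simpa using hk : k < N)
      refine ⟨le_trans (by positivity) hm.1, lt_of_lt_of_le hm.2 ?_⟩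
      rw [div_le_iff₀ hN']
      nlinarith
  rw [h, integral_finsetSum]
  · rw [Finset.mul_sum]
    refine Finset.sum_congr rfl fun k hk => ?_
    have hk : (k:ℝ) + 1 ≤ N := by exact_mod_cast (by simpa using hk : k < N)
    rw [integral_indicator measurableSet_Ico, Measure.restrict_restrict measurableSet_Ico,
      Set.inter_eq_left.2]
    · rw [setIntegral_const, Measure.real, Real.volume_Ico, ENNReal.toReal_ofReal]
      · rw [smul_eq_mul]; field_simp; ring
      · rw [← sub_div]; apply div_nonneg _ hN'.le; nlinarith
    · intro x hx
      refine ⟨le_trans (by positivity) hx.1, hx.2.le.trans ?_⟩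
      rw [div_le_iff₀ hN']
      nlinarith
  · intro k _
    exact (integrable_const _).indicator measurableSet_Ico

lemma floor_ref {δ : ℝ} (N Q : ℕ) (hQ : 0 < Q) (x : ℝ) :
    ⌊N * x / δ⌋₊ = ⌊(N * Q : ℕ) * x / δ⌋₊ / Q := by
  have hQ' : (0:ℝ) < Q := by exact_mod_cast hQ
  rw [← Nat.floor_div_natCast]
  congr 1
  push_cast
  field_simp

lemma ib {f : ℝ → ℝ} (hm : Measurable f) (F : ℝ) (h : ∀ x, |f x| ≤ F) :
    Integrable f (volume.restrict (Set.Icc (0:ℝ) 1)) :=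
  Integrable.of_bound hm.aestronglyMeasurable F (Eventually.of_forall h)

lemma ib2 {f g : ℝ → ℝ} (hm : Measurable f) (F : ℝ) (h : ∀ x, |f x| ≤ F)
    (hm' : Measurable g) (G : ℝ) (h' : ∀ x, |g x| ≤ G) :
    Integrable (fun x => f x * g x) (volume.restrict (Set.Icc (0:ℝ) 1)) := by
  refine ib (hm.mul hm') (F * G) fun x => ?_
  rw [abs_mul]
  exact mul_le_mul (h x) (h' x) (abs_nonneg _) ((abs_nonneg _).trans (h x))

/-- `f` is a uniform step function on `[0,δ)` -/
def StepL (δ : ℝ) (N : ℕ) (f : ℝ → ℝ) : Prop := ∃ c : ℕ → ℝ, ∀ x ∈ Set.Ico 0 δ, f x = c ⌊N * x / δ⌋₊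

lemma StepL.ref {δ : ℝ} {N : ℕ} {f : ℝ → ℝ} (h : StepL δ N f) {Q : ℕ} (hQ : 0 < Q) :
    StepL δ (N * Q) f := by
  obtain ⟨c, hc⟩ := h
  exact ⟨fun k => c (k / Q), fun x hx => by rw [hc x hx, floor_ref N Q hQ]⟩

lemma StepL.add {δ : ℝ} {N : ℕ} {f g : ℝ → ℝ} (h : StepL δ N f) (h' : StepL δ N g) :
    StepL δ N (fun x => f x + g x) := by
  obtain ⟨c, hc⟩ := h
  obtain ⟨c', hc'⟩ := h'
  exact ⟨fun k => c k + c' k, fun x hx => by simp only [hc x hx, hc' x hx]⟩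

lemma StepL.smul {δ : ℝ} {N : ℕ} {f : ℝ → ℝ} (h : StepL δ N f) (a : ℝ) :
    StepL δ N (fun x => a * f x) := by
  obtain ⟨c, hc⟩ := h
  exact ⟨fun k => a * c k, fun x hx => by simp only [hc x hx]⟩

lemma StepL.sum {δ : ℝ} {N : ℕ} {f : ℕ → ℝ → ℝ} {n : ℕ} (h : ∀ i, StepL δ N (f i)) :
    StepL δ N (fun x => ∑ i ∈ range n, f i x) := by
  choose c hc using h
  exact ⟨fun k => ∑ i ∈ range n, c i k, fun x hx => Finset.sum_congr rfl fun i _ => hc i x hx⟩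

lemma filler {δ : ℝ} (hδ : 0 < δ) (hδ1 : δ < 1) {N : ℕ} (hN : 0 < N) (K : ℕ) :
    ∃ (Q : ℕ) (U : ℕ → ℝ → ℝ), 0 < Q ∧ (∀ i, Measurable (U i)) ∧
      (∀ i x, |U i x| ≤ (√δ)⁻¹) ∧ (∀ i x, x ∉ Set.Ico 0 δ → U i x = 0) ∧
      (∀ i, StepL δ (N * Q) (U i)) ∧
      (∀ i < 2^K, ∀ j < 2^K, ∫ x in Set.Icc (0:ℝ) 1, U i x * U j x = (if i = j then 1 else 0) - ((2:ℝ)^K)⁻¹) ∧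
      (∀ f, StepL δ N f → ∀ i, ∫ x in Set.Icc (0:ℝ) 1, f x * U i x = 0) ∧
      (∀ x, ∑ i ∈ range (2^K), U i x = 0) ∧
      (∀ m ≤ 2^K, ∫ x in Set.Icc (0:ℝ) 1, |∑ i ∈ range m, U i x| ≤ K + 1) := by
  set d := (√δ)⁻¹ with hd
  have hsδ : 0 < √δ := Real.sqrt_pos.2 hδ
  have hd0 : 0 < d := by positivity
  have hdd : d * d = δ⁻¹ := by rw [hd, ← mul_inv, Real.mul_self_sqrt hδ.le]
  set Q := 2 * 2^K with hQ
  have hQ0 : 0 < Q := by positivity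
  have hNQ : 0 < N * Q := by positivity
  have hN' : (0:ℝ) < N := by exact_mod_cast hN
  have hQ' : (Q:ℝ) = 2 * 2^K := by rw [hQ]; push_cast; ring
  refine ⟨Q, fun i => TT δ (N * Q) (fun k => d * vv K i (k % Q)), hQ0, fun i => TT_meas _ _ _, ?_, ?_, ?_, ?_, ?_, ?_, ?_⟩
  · intro i x
    beta_reduce
    by_cases hx : x ∈ Set.Ico 0 δ
    · rw [TT_in hx, abs_mul, abs_of_pos hd0]
      exact mul_le_of_le_one_right hd0.le (vv_abs _ _ _)
    · rw [TT_out hx]; simpa using hd0.le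
  · intro i x hx; exact TT_out hx
  · intro i; exact ⟨fun k => d * vv K i (k % Q), fun x hx => TT_in hx⟩
  · intro i hi j hj
    have : (fun x => TT δ (N * Q) (fun k => d * vv K i (k % Q)) x * TT δ (N * Q) (fun k => d * vv K j (k % Q)) x) =
        TT δ (N * Q) (fun k => (fun _ r => δ⁻¹ * (vv K i r * vv K j r)) (k / Q) (k % Q)) := by
      apply TT_ext
      · intro x hx; rw [TT_in hx, TT_in hx, ← hdd]; ring
      · intro x hx; rw [TT_out hx, zero_mul]
    rw [this, TT_int hδ hδ1 hNQ, sum_divmod N Q hQ0 (fun _ r => δ⁻¹ * (vv K i r * vv K j r)),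
      ← Finset.mul_sum, ← Finset.mul_sum, vv_orth K i hi j hj]
    push_cast
    rw [hQ']
    split_ifs <;> simp <;> field_simp
  · rintro f ⟨c, hc⟩ i
    have : (fun x => f x * TT δ (N * Q) (fun k => d * vv K i (k % Q)) x) =
        TT δ (N * Q) (fun k => (fun a r => c a * d * vv K i r) (k / Q) (k % Q)) := by
      apply TT_ext
      · intro x hx; rw [TT_in hx, hc x hx, floor_ref N Q hQ0]; ring
      · intro x hx; rw [TT_out hx, mul_zero]
    rw [this, TT_int hδ hδ1 hNQ, sum_divmod N Q hQ0 (fun a r => c a * d * vv K i r)]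
    simp [← Finset.mul_sum, hQ, vv_mean]
  · intro x
    by_cases hx : x ∈ Set.Ico 0 δ
    · simp only [TT_in hx, ← Finset.mul_sum, vv_colsum, mul_zero]
    · simp only [TT_out hx, Finset.sum_const_zero]
  · intro m hm
    have : (fun x => |∑ i ∈ range m, TT δ (N * Q) (fun k => d * vv K i (k % Q)) x|) =
        TT δ (N * Q) (fun k => (fun _ r => d * |∑ i ∈ range m, vv K i r|) (k / Q) (k % Q)) := by
      apply TT_ext
      · intro x hx; simp only [TT_in hx, ← Finset.mul_sum, abs_mul, abs_of_pos hd0]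
      · intro x hx; simp only [TT_out hx, Finset.sum_const_zero, abs_zero]
    rw [this, TT_int hδ hδ1 hNQ, sum_divmod N Q hQ0 (fun _ r => d * |∑ i ∈ range m, vv K i r|)]
    rw [← Finset.mul_sum]
    have h := vv_leb K m hm
    rw [← hQ, ← hQ'] at h
    have hQp : (0:ℝ) < Q := by exact_mod_cast hQ0
    have hδd : δ * d ≤ 1 := by
      have : δ * d = √δ := by
        rw [hd]; nth_rewrite 1 [← Real.mul_self_sqrt hδ.le]; field_simp
      rw [this]; exact Real.sqrt_le_one.2 hδ1.le
    have hS : 0 ≤ ∑ r ∈ range Q, |∑ i ∈ range m, vv K i r| := Finset.sum_nonneg fun _ _ => abs_nonneg _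
    rw [Finset.sum_const, card_range, nsmul_eq_mul]
    push_cast
    calc δ / (N * Q) * (N * (d * ∑ r ∈ range Q, |∑ i ∈ range m, vv K i r|))
        = (δ * d) * ((∑ r ∈ range Q, |∑ i ∈ range m, vv K i r|) / Q) := by field_simp
      _ ≤ 1 * (K + 1) := by
        gcongr
        rw [div_le_iff₀ hQp]; exact h
      _ = _ := one_mul _

/-- the cell of `x` in the partition of `[δ,1]` by cut points `D` -/
def cell (δ : ℝ) (D : Finset ℝ) (x : ℝ) : Set ℝ :=
  {y | y ∈ Set.Icc δ 1 ∧ ∀ t ∈ D, (t ≤ x ↔ t ≤ y)}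

lemma cell_meas (δ : ℝ) (D : Finset ℝ) (x : ℝ) : MeasurableSet (cell δ D x) := by
  have : cell δ D x = Set.Icc δ 1 ∩ ⋂ t ∈ D, {y | t ≤ x ↔ t ≤ y} := by
    ext y; simp [cell]
  rw [this]
  refine measurableSet_Icc.inter (Finset.measurableSet_biInter _ fun t _ => ?_)
  by_cases h : t ≤ x
  · simp only [h, true_iff]; exact measurableSet_Ici
  · simp only [h, false_iff, not_le]; exact measurableSet_Iio

lemma cell_sub (δ : ℝ) (D : Finset ℝ) (x : ℝ) : cell δ D x ⊆ Set.Icc δ 1 := fun _ h => h.1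

lemma cell_congr {δ : ℝ} {D : Finset ℝ} {x y : ℝ} (h : y ∈ cell δ D x) : cell δ D y = cell δ D x := by
  ext z
  constructor
  · exact fun hz => ⟨hz.1, fun t ht => (h.2 t ht).trans (hz.2 t ht)⟩
  · exact fun hz => ⟨hz.1, fun t ht => (h.2 t ht).symm.trans (hz.2 t ht)⟩

lemma cell_self {δ : ℝ} {D : Finset ℝ} {x : ℝ} (h : x ∈ Set.Icc δ 1) : x ∈ cell δ D x :=
  ⟨h, fun _ _ => Iff.rfl⟩

lemma cell_symm {δ : ℝ} {D : Finset ℝ} {x y : ℝ} (hx : x ∈ Set.Icc δ 1) (h : y ∈ cell δ D x) :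
    x ∈ cell δ D y := ⟨hx, fun t ht => (h.2 t ht).symm⟩

/-- the averaging kernel -/
noncomputable def EE (δ : ℝ) (D : Finset ℝ) (x : ℝ) : ℝ → ℝ :=
  (cell δ D x).indicator (fun _ => (volume.real (cell δ D x))⁻¹)

lemma EE_int (δ : ℝ) (hδ : 0 < δ) (D : Finset ℝ) (x : ℝ) :
    ∫ τ in Set.Icc (0:ℝ) 1, EE δ D x τ ≤ 1 := by
  unfold EE
  rw [integral_indicator (cell_meas _ _ _), Measure.restrict_restrict (cell_meas _ _ _),
    Set.inter_eq_left.2 ((cell_sub _ _ _).trans (Set.Icc_subset_Icc_left hδ.le)), setIntegral_const, smul_eq_mul]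
  exact mul_inv_le_one

lemma EE_nonneg (δ : ℝ) (D : Finset ℝ) (x τ : ℝ) : 0 ≤ EE δ D x τ :=
  Set.indicator_nonneg (fun _ _ => by positivity) _

lemma ker_le {δ : ℝ} (hδ : 0 < δ) {D : Finset ℝ} {x : ℝ} {k : ℝ → ℝ}
    (h1 : ∀ τ ∈ Set.Ico 0 δ, k τ = 0) (h2 : ∀ τ ∈ Set.Icc δ 1, k τ = EE δ D x τ) :
    ∫ τ in Set.Icc (0:ℝ) 1, |k τ| ≤ 1 := by
  rw [setIntegral_congr_fun (g := EE δ D x) measurableSet_Icc]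
  · exact EE_int δ hδ D x
  · intro τ hτ
    beta_reduce
    by_cases h : τ < δ
    · rw [h1 τ ⟨hτ.1, h⟩, EE, Set.indicator_of_notMem, abs_zero]
      exact fun hh => absurd hh.1.1 (by linarith)
    · rw [h2 τ ⟨by linarith, hτ.2⟩, abs_of_nonneg (EE_nonneg _ _ _ _)]

/-- invariants of the finite system built so far -/
structure Good (δ : ℝ) (n : ℕ) (g : ℕ → ℝ → ℝ) (N : ℕ) (D : Finset ℝ) : Prop where
  meas : ∀ i, Measurable (g i)
  bdd : ∀ i x, |g i x| ≤ 1 + (√δ)⁻¹ + (√(1-δ))⁻¹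
  orth : ∀ i < n, ∀ j < n, ∫ x in Set.Icc (0:ℝ) 1, g i x * g j x = if i = j then 1 else 0
  out : ∀ i, ∀ x, x ∉ Set.Icc (0:ℝ) 1 → g i x = 0
  Npos : 0 < N
  Dsub : ∀ t ∈ D, t ∈ Set.Ioo δ 1
  stepL : ∀ i, StepL δ N (g i)
  stepR : ∀ i, ∀ x ∈ Set.Icc δ 1, ∀ y ∈ cell δ D x, g i y = g i x
  kerL : ∀ x ∈ Set.Icc δ 1, ∀ τ ∈ Set.Ico 0 δ, ∑ i ∈ range n, g i x * g i τ = 0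
  kerR : ∀ x ∈ Set.Icc δ 1, ∀ τ ∈ Set.Icc δ 1, ∑ i ∈ range n, g i x * g i τ = EE δ D x τ
  leb : ∀ x ∈ Set.Icc δ 1, ∀ m ≤ n, ∫ τ in Set.Icc (0:ℝ) 1, |∑ i ∈ range m, g i x * g i τ| ≤ 2

lemma exists_K (F : ℝ) : ∃ K : ℕ, F * (2 * K + 1) ≤ 2^K := by
  have h1 := tendsto_pow_const_div_const_pow_of_one_lt 1 (r := (2:ℝ)) (by norm_num)
  have h0 := tendsto_pow_const_div_const_pow_of_one_lt 0 (r := (2:ℝ)) (by norm_num)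
  have h := ((h1.const_mul 2).add h0).const_mul F
  simp only [mul_zero, add_zero] at h
  obtain ⟨K, hK⟩ := (h.eventually (eventually_lt_nhds zero_lt_one)).exists
  refine ⟨K, ?_⟩
  have h2 : (0:ℝ) < 2^K := by positivity
  have : F * (2 * ((K:ℝ)^1 / 2^K) + (K:ℝ)^0 / 2^K) = F * (2 * K + 1) / 2^K := by
    field_simp
  rw [this, div_lt_one h2] at hK
  exact hK.le

lemma block {δ : ℝ} (hδ : 0 < δ) (hδ1 : δ < 1) {n : ℕ} {g : ℕ → ℝ → ℝ} {N : ℕ} {D D' : Finset ℝ}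
    (hg : Good δ n g N D) {f : ℝ → ℝ} (fm : Measurable f) {F : ℝ} (fb : ∀ x, |f x| ≤ F)
    (fout : ∀ x, x ∉ Set.Icc (0:ℝ) 1 → f x = 0)
    (fnorm : ∫ x in Set.Icc (0:ℝ) 1, f x * f x = 1)
    (forth : ∀ i < n, ∫ x in Set.Icc (0:ℝ) 1, f x * g i x = 0)
    (fL : StepL δ N f) (fR : ∀ x ∈ Set.Icc δ 1, ∀ y ∈ cell δ D' x, f y = f x)
    (hD : D ⊆ D') (hD' : ∀ t ∈ D', t ∈ Set.Ioo δ 1)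
    (f0 : ∀ x ∈ Set.Icc δ 1, ∀ τ ∈ Set.Ico 0 δ, f x * f τ = 0)
    (fE : ∀ x ∈ Set.Icc δ 1, ∀ τ ∈ Set.Icc δ 1, EE δ D x τ + f x * f τ = EE δ D' x τ) :
    ∃ (n' : ℕ) (g' : ℕ → ℝ → ℝ) (N' : ℕ), Good δ n' g' N' D' ∧ n < n' ∧ (∀ i < n, g' i = g i) ∧
      ∃ a : ℕ → ℝ, ∀ x, f x = ∑ i ∈ range n', a i * g' i x := by
  have hF0 : 0 ≤ F := (abs_nonneg _).trans (fb 0)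
  obtain ⟨K, hK⟩ := exists_K F
  obtain ⟨Q, U, Q0, Um, Ub, Uout, UL, Uorth, Uf, Usum, Uleb⟩ := filler hδ hδ1 hg.Npos (2 * K)
  set q : ℝ := 2^K with hq
  have hq0 : 0 < q := by positivity
  have hFq : F ≤ q := by
    refine le_trans ?_ hK
    have : (0:ℝ) ≤ K := by positivity
    nlinarith
  have hM : (2:ℝ)^(2*K) = q * q := by rw [hq]; ring
  rw [hM] at Uorth
  set M := 2^(2*K) with hMdef
  have hM' : (M:ℝ) = q * q := by rw [hMdef, ← hM]; push_cast; rfl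
  have hM0 : 0 < M := by positivity
  have hd0 : 0 < (√δ)⁻¹ := by have := Real.sqrt_pos.2 hδ; positivity
  have he0 : 0 < (√(1-δ))⁻¹ := by
    have : 0 < √(1-δ) := Real.sqrt_pos.2 (by linarith)
    positivity
  set G : ℕ → ℝ → ℝ := fun i x => q⁻¹ * f x + U i x with hG
  have Gm : ∀ i, Measurable (G i) := fun i => (fm.const_mul _).add (Um i)
  have Gb : ∀ i x, |G i x| ≤ 1 + (√δ)⁻¹ := by
    intro i x
    refine (abs_add_le _ _).trans (add_le_add ?_ (Ub i x))
    rw [abs_mul, abs_of_pos (by positivity), inv_mul_le_iff₀ hq0]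
    linarith [fb x]
  have GR : ∀ i, ∀ x ∈ Set.Icc δ 1, G i x = q⁻¹ * f x := by
    intro i x hx
    simp only [hG]
    rw [Uout i x (fun h => absurd h.2 (by linarith [hx.1])), add_zero]
  set g' : ℕ → ℝ → ℝ := fun i => if i < n then g i else if i < n + M then G (i - n) else 0 with hg'
  have g1 : ∀ i < n, g' i = g i := fun i hi => by simp only [hg', hi, if_true]
  have g2 : ∀ i < M, g' (n + i) = G i := fun i hi => by
    simp only [hg']
    rw [if_neg (by omega), if_pos (by omega)]; simp
  have gcase : ∀ i, g' i = g i ∨ (∃ j, g' i = G j) ∨ g' i = 0 := by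
    intro i
    simp only [hg']
    split_ifs
    · exact Or.inl rfl
    · exact Or.inr (Or.inl ⟨_, rfl⟩)
    · exact Or.inr (Or.inr rfl)
  have ksplit : ∀ m ≤ M, ∀ x ∈ Set.Icc δ 1, ∀ τ, ∑ i ∈ range (n + m), g' i x * g' i τ =
      ∑ i ∈ range n, g i x * g i τ + m / (q * q) * (f x * f τ) + q⁻¹ * f x * ∑ i ∈ range m, U i τ := by
    intro m hm x hx τ
    rw [Finset.sum_range_add, add_assoc]
    congr 1
    · exact Finset.sum_congr rfl fun i hi => by rw [g1 i (by simpa using hi)]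
    · rw [Finset.sum_congr rfl (g := fun i => q⁻¹ * f x * (q⁻¹ * f τ) + q⁻¹ * f x * U i τ)]
      · rw [Finset.sum_add_distrib, ← Finset.mul_sum (f := fun i => U i τ), Finset.sum_const, card_range, nsmul_eq_mul]
        field_simp
      · intro i hi
        have hi : i < m := by simpa using hi
        rw [g2 i (by omega), GR i x hx]; simp only [hG]; ring
  have kfull : ∀ x ∈ Set.Icc δ 1, ∀ τ, ∑ i ∈ range (n + M), g' i x * g' i τ =
      ∑ i ∈ range n, g i x * g i τ + f x * f τ := by
    intro x hx τ
    rw [ksplit M le_rfl x hx τ, Usum, hM', div_self (by positivity)]; ring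
  have fgi : ∀ i, Integrable (fun x => f x * g i x) (volume.restrict (Set.Icc (0:ℝ) 1)) :=
    fun i => ib2 fm F fb (hg.meas i) _ (hg.bdd i)
  have crossorth : ∀ i < n, ∀ j, ∫ x in Set.Icc (0:ℝ) 1, g i x * G j x = 0 := by
    intro i hi j
    have : (fun x => g i x * G j x) = fun x => q⁻¹ * (f x * g i x) + g i x * U j x := by
      ext x; simp only [hG]; ring
    rw [this, integral_add ((fgi i).const_mul _) (ib2 (hg.meas i) _ (hg.bdd i) (Um j) _ (Ub j)),
      integral_const_mul, forth i hi, Uf _ (hg.stepL i), mul_zero, add_zero]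
  refine ⟨n + M, g', N * Q, ?_, by omega, g1, ?_⟩
  · refine ⟨?_, ?_, ?_, ?_, ?_, hD', ?_, ?_, ?_, ?_, ?_⟩
    · intro i
      rcases gcase i with h | ⟨j, h⟩ | h <;> rw [h]
      · exact hg.meas i
      · exact Gm j
      · exact measurable_const
    · intro i x
      rcases gcase i with h | ⟨j, h⟩ | h <;> rw [h]
      · exact hg.bdd i x
      · exact (Gb j x).trans (by linarith)
      · simp only [Pi.zero_apply, abs_zero]; positivity
    · intro i hi j hj
      by_cases hi' : i < n <;> by_cases hj' : j < n
      · rw [g1 i hi', g1 j hj']; exact hg.orth i hi' j hj'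
      · obtain ⟨j, rfl⟩ : ∃ k, j = n + k := ⟨j - n, by omega⟩
        rw [g1 i hi', g2 j (by omega), crossorth i hi', if_neg (by omega)]
      · obtain ⟨i, rfl⟩ : ∃ k, i = n + k := ⟨i - n, by omega⟩
        simp_rw [mul_comm]
        rw [g1 j hj', g2 i (by omega), crossorth j hj', if_neg (by omega)]
      · obtain ⟨j, rfl⟩ : ∃ k, j = n + k := ⟨j - n, by omega⟩
        obtain ⟨i, rfl⟩ : ∃ k, i = n + k := ⟨i - n, by omega⟩
        rw [g2 i (by omega), g2 j (by omega)]
        have : (fun x => G i x * G j x) = fun x => (q⁻¹ * q⁻¹ * (f x * f x) + (q⁻¹ * (f x * U i x) + q⁻¹ * (f x * U j x))) + U i x * U j x := by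
          ext x; simp only [hG]; ring
        have i1 := (ib2 fm F fb fm F fb).const_mul (q⁻¹ * q⁻¹)
        have i2 : ∀ i, Integrable (fun x => q⁻¹ * (f x * U i x)) (volume.restrict (Set.Icc (0:ℝ) 1)) := fun i => (ib2 fm F fb (Um i) _ (Ub i)).const_mul q⁻¹
        have i3 := ib2 (Um i) _ (Ub i) (Um j) _ (Ub j)
        rw [this, integral_add (i1.fun_add ((i2 i).fun_add (i2 j))) i3, integral_add i1 ((i2 i).fun_add (i2 j)),
          integral_add (i2 i) (i2 j), integral_const_mul, integral_const_mul, integral_const_mul,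
          Uf f fL, Uf f fL, fnorm, Uorth i (by omega) j (by omega)]
        simp only [Nat.add_left_cancel_iff, mul_inv]
        ring
    · intro i x hx
      rcases gcase i with h | ⟨j, h⟩ | h <;> rw [h]
      · exact hg.out i x hx
      · simp only [hG]
        rw [fout x hx, Uout j x (fun h => hx ⟨h.1, by linarith [h.2]⟩)]; simp
      · rfl
    · exact Nat.mul_pos hg.Npos Q0
    · intro i
      rcases gcase i with h | ⟨j, h⟩ | h <;> rw [h]
      · exact (hg.stepL i).ref Q0
      · exact ((fL.smul q⁻¹).ref Q0).add (UL j)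
      · exact ⟨fun _ => 0, fun _ _ => rfl⟩
    · intro i x hx y hy
      rcases gcase i with h | ⟨j, h⟩ | h <;> rw [h]
      · exact hg.stepR i x hx y ⟨hy.1, fun t ht => hy.2 t (hD ht)⟩
      · rw [GR j x hx, GR j y hy.1, fR x hx y hy]
      · rfl
    · intro x hx τ hτ
      rw [kfull x hx, hg.kerL x hx τ hτ, f0 x hx τ hτ, add_zero]
    · intro x hx τ hτ
      rw [kfull x hx, hg.kerR x hx τ hτ, fE x hx τ hτ]
    · intro x hx m hm
      by_cases hmn : m ≤ n
      · rw [setIntegral_congr_fun (g := fun τ => |∑ i ∈ range m, g i x * g i τ|) measurableSet_Icc]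
        · exact hg.leb x hx m hmn
        · intro τ _
          beta_reduce
          congr 1
          exact Finset.sum_congr rfl fun i hi => by rw [g1 i (by simp at hi; omega)]
      · obtain ⟨m, rfl⟩ : ∃ k, m = n + k := ⟨m - n, by omega⟩
        have hm : m ≤ M := by omega
        set θ : ℝ := m / (q * q) with hθ
        have hθ0 : 0 ≤ θ := by positivity
        have hθ1 : θ ≤ 1 := by
          rw [hθ, ← hM', div_le_one (by exact_mod_cast hM0)]; exact_mod_cast hm
        set k0 : ℝ → ℝ := fun τ => ∑ i ∈ range n, g i x * g i τ with hk0
        set k1 : ℝ → ℝ := fun τ => ∑ i ∈ range n, g i x * g i τ + f x * f τ with hk1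
        set S : ℝ → ℝ := fun τ => ∑ i ∈ range m, U i τ with hS
        have I0 : ∫ τ in Set.Icc (0:ℝ) 1, |k0 τ| ≤ 1 :=
          ker_le hδ (hg.kerL x hx) (hg.kerR x hx)
        have I1 : ∫ τ in Set.Icc (0:ℝ) 1, |k1 τ| ≤ 1 := by
          refine ker_le hδ (D := D') (x := x) ?_ ?_
          · intro τ hτ; simp only [hk1]; rw [hg.kerL x hx τ hτ, f0 x hx τ hτ, add_zero]
          · intro τ hτ; simp only [hk1]; rw [hg.kerR x hx τ hτ, fE x hx τ hτ]
        have I2 : ∫ τ in Set.Icc (0:ℝ) 1, |S τ| ≤ 2 * K + 1 := by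
          have := Uleb m hm
          push_cast at this
          exact this
        have J0' : Integrable k0 (volume.restrict (Set.Icc (0:ℝ) 1)) :=
          integrable_finsetSum _ fun i _ => (ib (hg.meas i) _ (hg.bdd i)).const_mul _
        have J0 := J0'.abs
        have J1' : Integrable k1 (volume.restrict (Set.Icc (0:ℝ) 1)) :=
          J0'.add ((ib fm F fb).const_mul _)
        have J1 := J1'.abs
        have J2' : Integrable S (volume.restrict (Set.Icc (0:ℝ) 1)) :=
          integrable_finsetSum _ fun i _ => ib (Um i) _ (Ub i)
        have J2 := J2'.abs
        have hJ : Integrable (fun τ => (1 - θ) * |k0 τ| + θ * |k1 τ| + q⁻¹ * F * |S τ|) (volume.restrict (Set.Icc (0:ℝ) 1)) :=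
          ((J0.const_mul _).add (J1.const_mul _)).add (J2.const_mul _)
        calc ∫ τ in Set.Icc (0:ℝ) 1, |∑ i ∈ range (n + m), g' i x * g' i τ|
            ≤ ∫ τ in Set.Icc (0:ℝ) 1, ((1 - θ) * |k0 τ| + θ * |k1 τ| + q⁻¹ * F * |S τ|) := by
              refine integral_mono_of_nonneg (Eventually.of_forall fun _ => abs_nonneg _) hJ
                (Eventually.of_forall fun τ => ?_)
              beta_reduce
              rw [ksplit m hm x hx τ]
              have : ∑ i ∈ range n, g i x * g i τ + θ * (f x * f τ) + q⁻¹ * f x * ∑ i ∈ range m, U i τ =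
                  (1 - θ) * k0 τ + θ * k1 τ + q⁻¹ * f x * S τ := by
                simp only [hk0, hk1, hS]; ring
              rw [this]
              refine (abs_add_le _ _).trans (add_le_add ((abs_add_le _ _).trans (add_le_add ?_ ?_)) ?_)
              · rw [abs_mul, abs_of_nonneg (by linarith : 0 ≤ 1 - θ)]
              · rw [abs_mul, abs_of_nonneg hθ0]
              · rw [abs_mul, abs_mul, abs_of_pos (by positivity : 0 < q⁻¹)]
                gcongr
                exact fb x
          _ = (1 - θ) * (∫ τ in Set.Icc (0:ℝ) 1, |k0 τ|) + θ * (∫ τ in Set.Icc (0:ℝ) 1, |k1 τ|)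
                + q⁻¹ * F * (∫ τ in Set.Icc (0:ℝ) 1, |S τ|) := by
              rw [integral_add ((J0.const_mul _).fun_add (J1.const_mul _)) (J2.const_mul _),
                integral_add (J0.const_mul _) (J1.const_mul _), integral_const_mul,
                integral_const_mul, integral_const_mul]
          _ ≤ (1 - θ) * 1 + θ * 1 + q⁻¹ * F * (2 * K + 1) := by
              gcongr
          _ ≤ 2 := by
              have : q⁻¹ * F * (2 * K + 1) ≤ 1 := by
                rw [mul_assoc, inv_mul_le_iff₀ hq0, mul_one]; exact hK
              linarith
  · refine ⟨fun i => if i < n then 0 else q⁻¹, fun x => ?_⟩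
    rw [Finset.sum_range_add, Finset.sum_eq_zero, zero_add]
    · rw [Finset.sum_congr rfl (g := fun i => q⁻¹ * (q⁻¹ * f x) + q⁻¹ * U i x)]
      · rw [Finset.sum_add_distrib, ← Finset.mul_sum (f := fun i => U i x), Usum, Finset.sum_const, card_range, nsmul_eq_mul, hM']
        field_simp; ring
      · intro i hi
        beta_reduce
        rw [if_neg (by omega), g2 i (by simpa using hi)]
        simp only [hG]; ring
    · intro i hi; beta_reduce; rw [if_pos (by simpa using hi), zero_mul]

lemma cell_fin (δ : ℝ) (D : Finset ℝ) (x : ℝ) (S : Set ℝ) : volume (cell δ D x ∩ S) ≠ ⊤ :=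
  ne_top_of_le_ne_top (b := volume (Set.Icc δ 1)) (by simp)
    (measure_mono (Set.inter_subset_left.trans (cell_sub _ _ _)))

lemma pos_right {δ : ℝ} {D : Finset ℝ} {x : ℝ} (hx : x ∈ Set.Ico δ 1) :
    0 < volume.real (cell δ D x ∩ Set.Ici x) := by
  have h : ∀ᶠ y in nhdsWithin x (Set.Ioi x), y ∈ cell δ D x ∩ Set.Ici x := by
    have h1 : ∀ᶠ y in nhdsWithin x (Set.Ioi x), y < 1 :=
      nhdsWithin_le_nhds (eventually_lt_nhds hx.2)
    have h2 : ∀ᶠ y in nhdsWithin x (Set.Ioi x), ∀ t ∈ D, x < t → y < t := by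
      rw [Filter.eventually_all_finset]
      intro t _
      by_cases ht : x < t
      · filter_upwards [nhdsWithin_le_nhds (eventually_lt_nhds ht)] with y hy _ using hy
      · exact Eventually.of_forall fun y h => absurd h ht
    filter_upwards [h1, h2, self_mem_nhdsWithin] with y hy1 hy2 hy3
    have hy3 : x < y := hy3
    refine ⟨⟨⟨hx.1.trans hy3.le, hy1.le⟩, fun t ht => ⟨fun h => h.trans hy3.le, fun h => ?_⟩⟩, hy3.le⟩
    by_contra hh
    exact absurd (hy2 t ht (not_le.1 hh)) (not_lt.2 h)
  obtain ⟨u, hu, hsub⟩ := mem_nhdsGT_iff_exists_Ioo_subset.1 h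
  have hu : x < u := hu
  refine lt_of_lt_of_le ?_ (measureReal_mono hsub (cell_fin _ _ _ _))
  rw [Measure.real, Real.volume_Ioo, ENNReal.toReal_ofReal] <;> linarith

lemma pos_left {δ : ℝ} {D : Finset ℝ} {x : ℝ} (hx : x ∈ Set.Ioc δ 1) (hD : x ∉ D) :
    0 < volume.real (cell δ D x ∩ Set.Iio x) := by
  have h : ∀ᶠ y in nhdsWithin x (Set.Iio x), y ∈ cell δ D x ∩ Set.Iio x := by
    have h1 : ∀ᶠ y in nhdsWithin x (Set.Iio x), δ < y :=
      nhdsWithin_le_nhds (eventually_gt_nhds hx.1)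
    have h2 : ∀ᶠ y in nhdsWithin x (Set.Iio x), ∀ t ∈ D, t < x → t < y := by
      rw [Filter.eventually_all_finset]
      intro t _
      by_cases ht : t < x
      · filter_upwards [nhdsWithin_le_nhds (eventually_gt_nhds ht)] with y hy _ using hy
      · exact Eventually.of_forall fun y h => absurd h ht
    filter_upwards [h1, h2, self_mem_nhdsWithin] with y hy1 hy2 hy3
    have hy3 : y < x := hy3
    refine ⟨⟨⟨hy1.le, hy3.le.trans hx.2⟩, fun t ht => ⟨fun h => ?_, fun h => h.trans hy3.le⟩⟩, hy3⟩
    exact (hy2 t ht (lt_of_le_of_ne h (fun h' => hD (h' ▸ ht)))).le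
  obtain ⟨u, hu, hsub⟩ := mem_nhdsLT_iff_exists_Ioo_subset.1 h
  have hu : u < x := hu
  refine lt_of_lt_of_le ?_ (measureReal_mono hsub (cell_fin _ _ _ _))
  rw [Measure.real, Real.volume_Ioo, ENNReal.toReal_ofReal] <;> linarith

lemma cell_pos {δ : ℝ} (hδ1 : δ < 1) {D : Finset ℝ} (hD : ∀ t ∈ D, t ∈ Set.Ioo δ 1) {x : ℝ}
    (hx : x ∈ Set.Icc δ 1) : 0 < volume.real (cell δ D x) := by
  have key : ∀ S, volume.real (cell δ D x ∩ S) ≤ volume.real (cell δ D x) := fun S =>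
    measureReal_mono Set.inter_subset_left (by simpa using cell_fin δ D x Set.univ)
  rcases lt_or_eq_of_le hx.2 with h | h
  · exact (pos_right ⟨hx.1, h⟩).trans_le (key _)
  · subst h
    exact (pos_left ⟨hδ1, le_rfl⟩ (fun h => absurd (hD _ h).2 (lt_irrefl _))).trans_le (key _)

lemma ind_int {δ : ℝ} (hδ : 0 < δ) {A : Set ℝ} (hA : MeasurableSet A) (hs : A ⊆ Set.Icc δ 1) (c : ℝ) :
    ∫ x in Set.Icc (0:ℝ) 1, A.indicator (fun _ => c) x = volume.real A * c := by
  rw [integral_indicator hA, Measure.restrict_restrict hA,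
    Set.inter_eq_left.2 (hs.trans (Set.Icc_subset_Icc_left hδ.le)), setIntegral_const, smul_eq_mul]

lemma splitR {δ : ℝ} (hδ : 0 < δ) (hδ1 : δ < 1) {n : ℕ} {g : ℕ → ℝ → ℝ} {N : ℕ} {D : Finset ℝ}
    (hg : Good δ n g N D) {t : ℝ} (ht : t ∈ Set.Ioo δ 1) (htD : t ∉ D) :
    ∃ (n' : ℕ) (g' : ℕ → ℝ → ℝ) (N' : ℕ), Good δ n' g' N' (insert t D) ∧ n < n' ∧
      (∀ i < n, g' i = g i) := by
  set A := cell δ D t ∩ Set.Iio t with hA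
  set B := cell δ D t ∩ Set.Ici t with hB
  have mA : MeasurableSet A := (cell_meas _ _ _).inter measurableSet_Iio
  have mB : MeasurableSet B := (cell_meas _ _ _).inter measurableSet_Ici
  have sA : A ⊆ Set.Icc δ 1 := Set.inter_subset_left.trans (cell_sub _ _ _)
  have sB : B ⊆ Set.Icc δ 1 := Set.inter_subset_left.trans (cell_sub _ _ _)
  set a := volume.real A with ha
  set b := volume.real B with hb
  have a0 : 0 < a := pos_left ⟨ht.1, ht.2.le⟩ htD
  have b0 : 0 < b := pos_right ⟨ht.1.le, ht.2⟩
  have hdisj : ∀ x ∈ A, x ∉ B := fun x h1 h2 => (not_lt.2 (Set.mem_Ici.1 h2.2)) (Set.mem_Iio.1 h1.2)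
  have hunion : cell δ D t = A ∪ B := by
    ext x; simp only [hA, hB, Set.mem_union, Set.mem_inter_iff, Set.mem_Iio, Set.mem_Ici]
    rcases lt_or_ge x t with h | h <;> simp [h]
  have hab : volume.real (cell δ D t) = a + b := by
    rw [hunion, measureReal_union (Set.disjoint_left.2 hdisj) mB (cell_fin _ _ _ _) (cell_fin _ _ _ _)]
  set γ := (√(a * b * (a + b)))⁻¹ with hγ
  have hγγ : γ * γ = (a * b * (a + b))⁻¹ := by
    rw [hγ, ← mul_inv, Real.mul_self_sqrt (by positivity)]
  set f : ℝ → ℝ := fun x => A.indicator (fun _ => γ * b) x + B.indicator (fun _ => -(γ * a)) x with hf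
  have fA : ∀ x ∈ A, f x = γ * b := fun x hx => by
    simp only [hf, Set.indicator_of_mem hx, Set.indicator_of_notMem (hdisj x hx), add_zero]
  have fB : ∀ x ∈ B, f x = -(γ * a) := fun x hx => by
    simp only [hf, Set.indicator_of_mem hx, Set.indicator_of_notMem (fun h => hdisj x h hx), zero_add]
  have fO : ∀ x, x ∉ cell δ D t → f x = 0 := fun x hx => by
    rw [hunion] at hx
    simp only [hf, Set.indicator_of_notMem (fun h => hx (Or.inl h) : x ∉ A), Set.indicator_of_notMem (fun h => hx (Or.inr h) : x ∉ B), zero_add]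
  have f0 : ∀ τ ∈ Set.Ico 0 δ, f τ = 0 := fun τ hτ => fO τ fun h => absurd h.1.1 (not_le.2 hτ.2)
  have iA : ∀ c : ℝ, Integrable (A.indicator (fun _ => c)) (volume.restrict (Set.Icc (0:ℝ) 1)) :=
    fun c => (integrable_const c).indicator mA
  have iB : ∀ c : ℝ, Integrable (B.indicator (fun _ => c)) (volume.restrict (Set.Icc (0:ℝ) 1)) :=
    fun c => (integrable_const c).indicator mB
  have tri : ∀ x, x ∈ A ∨ x ∈ B ∨ x ∉ cell δ D t := fun x => by
    rw [hunion]; by_cases h1 : x ∈ A <;> by_cases h2 : x ∈ B <;> simp [h1, h2]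
  have mono' : ∀ x y, y ∈ cell δ (insert t D) x → y ∈ cell δ D x ∧ (t ≤ x ↔ t ≤ y) := fun x y h =>
    ⟨⟨h.1, fun s hs => h.2 s (Finset.mem_insert_of_mem hs)⟩, h.2 t (Finset.mem_insert_self _ _)⟩
  have mono'' : ∀ x y, y ∈ cell δ D x → (t ≤ x ↔ t ≤ y) → y ∈ cell δ (insert t D) x := by
    intro x y h h'
    refine ⟨h.1, fun s hs => ?_⟩
    rcases Finset.mem_insert.1 hs with rfl | hs
    · exact h'
    · exact h.2 s hs
  have cA : ∀ x ∈ A, cell δ (insert t D) x = A := by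
    intro x hx
    have e := cell_congr hx.1
    have hx2 : x < t := hx.2
    ext y
    constructor
    · intro hy
      obtain ⟨h1, h2⟩ := mono' x y hy
      exact ⟨e ▸ h1, lt_of_not_ge fun h => absurd (h2.2 h) (not_le.2 hx2)⟩
    · rintro ⟨h1, h2⟩
      have h2 : y < t := h2
      exact mono'' x y (by rw [e]; exact h1) ⟨fun h => absurd h (not_le.2 hx2), fun h => absurd h (not_le.2 h2)⟩
  have cB : ∀ x ∈ B, cell δ (insert t D) x = B := by
    intro x hx
    have e := cell_congr hx.1
    have hx2 : t ≤ x := hx.2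
    ext y
    constructor
    · intro hy
      obtain ⟨h1, h2⟩ := mono' x y hy
      exact ⟨e ▸ h1, h2.1 hx2⟩
    · rintro ⟨h1, h2⟩
      have h2 : t ≤ y := h2
      exact mono'' x y (by rw [e]; exact h1) ⟨fun _ => h2, fun _ => hx2⟩
  have cO : ∀ x ∈ Set.Icc δ 1, x ∉ cell δ D t → cell δ (insert t D) x = cell δ D x := by
    intro x hx hxt
    ext y
    refine ⟨fun h => (mono' x y h).1, fun h => mono'' x y h ⟨fun h1 => ?_, fun h1 => ?_⟩⟩
    · by_contra h2
      push Not at h2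
      exact hxt ⟨hx, fun s hs => ⟨fun h3 => h3.trans h1, fun h3 => ((h.2 s hs).1 h3).trans h2.le⟩⟩
    · by_contra h2
      push Not at h2
      exact hxt ⟨hx, fun s hs => ⟨fun h3 => (h.2 s hs).2 (h3.trans h1), fun h3 => h3.trans h2.le⟩⟩
  have fm : Measurable f := (measurable_const.indicator mA).add (measurable_const.indicator mB)
  have γ0 : 0 < γ := by positivity
  have key := block hδ hδ1 hg (f := f) (F := γ * a + γ * b) (D' := insert t D) fm
    ?_ ?_ ?_ ?_ ?_ ?_ (Finset.subset_insert _ _) ?_ ?_ ?_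
  rotate_left
  · intro x
    have : 0 < γ * a := by positivity
    have : 0 < γ * b := by positivity
    rcases tri x with h | h | h
    · rw [fA x h, abs_of_pos (by positivity)]; linarith
    · rw [fB x h, abs_neg, abs_of_pos (by positivity)]; linarith
    · rw [fO x h, abs_zero]; positivity
  · intro x hx
    exact fO x fun h => hx ⟨hδ.le.trans h.1.1, h.1.2⟩
  · have : (fun x => f x * f x) = fun x => A.indicator (fun _ => γ * γ * b * b) x + B.indicator (fun _ => γ * γ * a * a) x := by
      ext x
      rcases tri x with h | h | h
      · rw [fA x h, Set.indicator_of_mem h, Set.indicator_of_notMem (hdisj x h)]; ring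
      · rw [fB x h, Set.indicator_of_mem h, Set.indicator_of_notMem (fun h' => hdisj x h' h)]; ring
      · rw [fO x h]
        rw [hunion] at h
        rw [Set.indicator_of_notMem (fun h' => h (Or.inl h')), Set.indicator_of_notMem (fun h' => h (Or.inr h'))]; ring
    rw [this, integral_add (iA _) (iB _), ind_int hδ mA sA, ind_int hδ mB sB, hγγ, ← ha, ← hb]
    field_simp; ring
  · intro i _
    have : ∀ x, f x * g i x = g i t * f x := by
      intro x
      by_cases h : x ∈ cell δ D t
      · rw [hg.stepR i t ⟨ht.1.le, ht.2.le⟩ x h]; ring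
      · rw [fO x h]; ring
    simp_rw [this]
    rw [integral_const_mul]
    simp only [hf]
    rw [integral_add (iA _) (iB _), ind_int hδ mA sA, ind_int hδ mB sB, ← ha, ← hb]
    ring
  · exact ⟨fun _ => 0, fun x hx => f0 x hx⟩
  · intro x hx y hy
    rcases tri x with h | h | h
    · rw [cA x h] at hy; rw [fA x h, fA y hy]
    · rw [cB x h] at hy; rw [fB x h, fB y hy]
    · rw [cO x hx h] at hy
      rw [fO x h, fO y fun hh => h ?_]
      rw [← cell_congr hh]; exact cell_symm hx hy
  · intro s hs
    rcases Finset.mem_insert.1 hs with rfl | hs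
    · exact ht
    · exact hg.Dsub s hs
  · intro x _ τ hτ; rw [f0 τ hτ, mul_zero]
  · intro x hx τ hτ
    unfold EE
    rcases tri x with h | h | h
    · rw [cA x h, cell_congr (Set.inter_subset_left h), hab, ← ha, fA x h]
      rcases tri τ with h' | h' | h'
      · rw [fA τ h', Set.indicator_of_mem h', Set.indicator_of_mem (Set.inter_subset_left h')]
        have : γ * b * (γ * b) = γ * γ * b * b := by ring
        rw [this, hγγ]; field_simp
      · rw [fB τ h', Set.indicator_of_notMem (fun h'' => hdisj τ h'' h'), Set.indicator_of_mem (Set.inter_subset_left h')]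
        have : γ * b * -(γ * a) = - (γ * γ * a * b) := by ring
        rw [this, hγγ]; field_simp; ring
      · rw [fO τ h', Set.indicator_of_notMem h', Set.indicator_of_notMem (fun h'' => h' (Set.inter_subset_left h''))]; ring
    · rw [cB x h, cell_congr (Set.inter_subset_left h), hab, ← hb, fB x h]
      rcases tri τ with h' | h' | h'
      · rw [fA τ h', Set.indicator_of_notMem (hdisj τ h'), Set.indicator_of_mem (Set.inter_subset_left h')]
        have : -(γ * a) * (γ * b) = - (γ * γ * a * b) := by ring
        rw [this, hγγ]; field_simp; ring
      · rw [fB τ h', Set.indicator_of_mem h', Set.indicator_of_mem (Set.inter_subset_left h')]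
        have : -(γ * a) * -(γ * a) = γ * γ * a * a := by ring
        rw [this, hγγ]; field_simp; ring
      · rw [fO τ h', Set.indicator_of_notMem h', Set.indicator_of_notMem (fun h'' => h' (Set.inter_subset_left h''))]; ring
    · rw [cO x hx h, fO x h, zero_mul, add_zero]
  · obtain ⟨n', g', N', h1, h2, h3, -⟩ := key
    exact ⟨n', g', N', h1, h2, h3⟩

lemma Good.ref {δ : ℝ} {n : ℕ} {g : ℕ → ℝ → ℝ} {N : ℕ} {D : Finset ℝ}
    (hg : Good δ n g N D) {Q : ℕ} (hQ : 0 < Q) : Good δ n g (N * Q) D :=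
  { hg with Npos := Nat.mul_pos hg.Npos hQ, stepL := fun i => (hg.stepL i).ref hQ }

lemma addL {δ : ℝ} (hδ : 0 < δ) (hδ1 : δ < 1) {n : ℕ} {g : ℕ → ℝ → ℝ} {N : ℕ} {D : Finset ℝ}
    (hg0 : Good δ n g N D) {N0 : ℕ} (hN0 : 0 < N0) (c : ℕ → ℝ) (C : ℝ) (hC : ∀ k, |c k| ≤ C) :
    ∃ (n' : ℕ) (g' : ℕ → ℝ → ℝ) (N' : ℕ), Good δ n' g' N' D ∧ n ≤ n' ∧
      (∀ i < n, g' i = g i) ∧ ∃ a : ℕ → ℝ, ∀ x, TT δ N0 c x = ∑ i ∈ range n', a i * g' i x := by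
  have hg := hg0.ref hN0
  set N' := N * N0 with hN'
  have hC0 : 0 ≤ C := (abs_nonneg _).trans (hC 0)
  set φ := TT δ N0 c with hφ
  have φm : Measurable φ := TT_meas _ _ _
  have φb : ∀ x, |φ x| ≤ C := by
    intro x
    by_cases hx : x ∈ Set.Ico 0 δ
    · rw [hφ, TT_in hx]; exact hC _
    · rw [hφ, TT_out hx, abs_zero]; exact hC0
  have φL : StepL δ N' φ := by
    rw [hN', mul_comm]
    exact StepL.ref ⟨c, fun x hx => TT_in hx⟩ hg0.Npos
  set B := 1 + (√δ)⁻¹ + (√(1-δ))⁻¹ with hB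
  set b : ℕ → ℝ := fun i => ∫ x in Set.Icc (0:ℝ) 1, φ x * g i x with hb
  set r : ℝ → ℝ := fun x => φ x + -1 * ∑ i ∈ range n, b i * g i x with hr
  have rm : Measurable r :=
    φm.add ((Finset.measurable_fun_sum _ fun i _ => (hg.meas i).const_mul _).const_mul _)
  set R0 := C + ∑ i ∈ range n, |b i| * B with hR0
  have rb : ∀ x, |r x| ≤ R0 := by
    intro x
    refine (abs_add_le _ _).trans (add_le_add (φb x) ?_)
    rw [neg_one_mul, abs_neg]
    refine (Finset.abs_sum_le_sum_abs _ _).trans (Finset.sum_le_sum fun i _ => ?_)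
    rw [abs_mul]
    exact mul_le_mul_of_nonneg_left (hg.bdd i x) (abs_nonneg _)
  have rout : ∀ x, x ∉ Set.Icc (0:ℝ) 1 → r x = 0 := by
    intro x hx
    simp only [hr, hg.out _ x hx, mul_zero, Finset.sum_const_zero, add_zero]
    exact TT_out fun h => hx ⟨h.1, by linarith [h.2]⟩
  have rL : StepL δ N' r := φL.add ((StepL.sum fun i => (hg.stepL i).smul (b i)).smul (-1))
  have φg : ∀ i, Integrable (fun x => φ x * g i x) (volume.restrict (Set.Icc (0:ℝ) 1)) :=
    fun i => ib2 φm C φb (hg.meas i) _ (hg.bdd i)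
  have rR : ∀ x ∈ Set.Icc δ 1, r x = 0 := by
    intro x hx
    have h1 : φ x = 0 := TT_out fun h => absurd h.2 (not_lt.2 hx.1)
    have h2 : ∑ i ∈ range n, b i * g i x = ∫ τ in Set.Icc (0:ℝ) 1, φ τ * ∑ i ∈ range n, g i x * g i τ := by
      have : ∀ τ, φ τ * ∑ i ∈ range n, g i x * g i τ = ∑ i ∈ range n, (φ τ * g i τ) * g i x := by
        intro τ; rw [Finset.mul_sum]; exact Finset.sum_congr rfl fun i _ => by ring
      simp_rw [this]
      rw [integral_finsetSum _ fun i _ => (φg i).mul_const _]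
      simp_rw [integral_mul_const]
      rfl
    have h3 : ∀ τ, φ τ * ∑ i ∈ range n, g i x * g i τ = 0 := by
      intro τ
      by_cases hτ : τ ∈ Set.Ico 0 δ
      · rw [hg.kerL x hx τ hτ, mul_zero]
      · rw [hφ, TT_out hτ, zero_mul]
    simp only [hr]
    rw [h1, h2]
    simp [h3]
  have rorth : ∀ j < n, ∫ x in Set.Icc (0:ℝ) 1, r x * g j x = 0 := by
    intro j hj
    have : ∀ x, r x * g j x = φ x * g j x + -1 * ∑ i ∈ range n, b i * (g i x * g j x) := by
      intro x
      simp only [hr]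
      rw [add_mul, mul_assoc, Finset.sum_mul]
      congr 2
      exact Finset.sum_congr rfl fun i _ => by ring
    simp_rw [this]
    have gg : ∀ i, Integrable (fun x => b i * (g i x * g j x)) (volume.restrict (Set.Icc (0:ℝ) 1)) :=
      fun i => (ib2 (hg.meas i) _ (hg.bdd i) (hg.meas j) _ (hg.bdd j)).const_mul _
    rw [integral_add (φg j) ((integrable_finsetSum _ fun i _ => gg i).const_mul _), integral_const_mul,
      integral_finsetSum _ fun i _ => gg i]
    simp_rw [integral_const_mul]
    rw [Finset.sum_congr rfl (g := fun i => if i = j then b i else 0)]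
    · rw [Finset.sum_ite_eq', if_pos (by simpa using hj)]
      simp only [hb]; ring
    · intro i hi
      rw [hg.orth i (by simpa using hi) j hj]; simp
  set R := ∫ x in Set.Icc (0:ℝ) 1, r x * r x with hR
  have hRnn : 0 ≤ R := integral_nonneg fun x => mul_self_nonneg _
  rcases hRnn.eq_or_lt with hR0' | hRpos
  ·
    refine ⟨n, g, N', hg, le_rfl, fun _ _ => rfl, b, fun x => ?_⟩
    have hr0 : r x = 0 := by
      by_cases hx : x ∈ Set.Ico 0 δ
      · obtain ⟨d, hd⟩ := rL
        have e : (fun x => r x * r x) = TT δ N' (fun k => d k * d k) := by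
          apply TT_ext
          · intro x hx; rw [hd x hx]
          · intro x hx
            by_cases h : x ∈ Set.Icc (0:ℝ) 1
            · rw [rR x ⟨not_lt.1 fun h' => hx ⟨h.1, h'⟩, h.2⟩, mul_zero]
            · rw [rout x h, mul_zero]
        rw [hR, e, TT_int hδ hδ1 hg.Npos] at hR0'
        have hNp : (0:ℝ) < N' := by exact_mod_cast hg.Npos
        have hz : ∑ k ∈ range N', d k * d k = 0 := by
          rcases mul_eq_zero.1 hR0'.symm with h | h
          · exact absurd h (by positivity)
          · exact h
        rw [Finset.sum_eq_zero_iff_of_nonneg fun k _ => mul_self_nonneg _] at hz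
        have := hz _ (Finset.mem_range.2 (TT_floor_lt hδ hg.Npos hx))
        rw [hd x hx]; exact mul_self_eq_zero.1 this
      · by_cases h : x ∈ Set.Icc (0:ℝ) 1
        · exact rR x ⟨not_lt.1 fun h' => hx ⟨h.1, h'⟩, h.2⟩
        · exact rout x h
    simp only [hr] at hr0
    linarith
  · have hs : 0 < √R := Real.sqrt_pos.2 hRpos
    have key := block hδ hδ1 hg (f := fun x => (√R)⁻¹ * r x)
      (F := (√R)⁻¹ * R0) (D' := D) (rm.const_mul _) ?_ ?_ ?_ ?_ (rL.smul _) ?_ subset_rfl hg.Dsub ?_ ?_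
    rotate_left
    · intro x
      rw [abs_mul, abs_of_pos (by positivity)]
      exact mul_le_mul_of_nonneg_left (rb x) (by positivity)
    · intro x hx; rw [rout x hx, mul_zero]
    · have : ∀ x, (√R)⁻¹ * r x * ((√R)⁻¹ * r x) = R⁻¹ * (r x * r x) := by
        intro x
        have : (√R)⁻¹ * (√R)⁻¹ = R⁻¹ := by rw [← mul_inv, Real.mul_self_sqrt hRnn]
        rw [← this]; ring
      simp_rw [this]
      rw [integral_const_mul, ← hR, inv_mul_cancel₀ hRpos.ne']
    · intro i hi
      simp_rw [mul_assoc]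
      rw [integral_const_mul, rorth i hi, mul_zero]
    · intro x hx y hy; rw [rR x hx, rR y hy.1]
    · intro x hx τ _; rw [rR x hx]; ring
    · intro x hx τ _; rw [rR x hx]; ring
    · obtain ⟨n', g', N'', h1, h2, h3, a, h4⟩ := key
      refine ⟨n', g', N'', h1, h2.le, h3, fun i => √R * a i + if i < n then b i else 0, fun x => ?_⟩
      have e1 : ∑ i ∈ range n', (√R * a i + if i < n then b i else 0) * g' i x =
          √R * ∑ i ∈ range n', a i * g' i x + ∑ i ∈ range n', (if i < n then b i else 0) * g' i x := by
        rw [Finset.mul_sum, ← Finset.sum_add_distrib]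
        exact Finset.sum_congr rfl fun i _ => by ring
      have e2 : ∑ i ∈ range n', (if i < n then b i else 0) * g' i x = ∑ i ∈ range n, b i * g i x := by
        rw [← Finset.sum_subset (Finset.range_mono h2.le)]
        · refine Finset.sum_congr rfl fun i hi => ?_
          have hi : i < n := by simpa using hi
          rw [if_pos hi, h3 i hi]
        · intro i _ hi
          rw [if_neg (by simpa using hi), zero_mul]
      rw [e1, e2, ← h4 x, mul_inv_cancel_left₀ hs.ne']
      simp only [hr]; ring

lemma initGood {δ : ℝ} (hδ : 0 < δ) (hδ1 : δ < 1) :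
    Good δ 1 (fun i => (Set.Icc δ 1).indicator (fun _ => if i = 0 then (√(1-δ))⁻¹ else 0)) 1 ∅ := by
  have hp : 0 < 1 - δ := by linarith
  have hs : (√(1-δ))⁻¹ * (√(1-δ))⁻¹ = (1-δ)⁻¹ := by
    rw [← mul_inv, Real.mul_self_sqrt hp.le]
  have hs0 : 0 < (√(1-δ))⁻¹ := inv_pos.2 (Real.sqrt_pos.2 hp)
  have hd0 : 0 < (√δ)⁻¹ := inv_pos.2 (Real.sqrt_pos.2 hδ)
  have hc : ∀ x, cell δ ∅ x = Set.Icc δ 1 := fun x => by ext y; simp [cell]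
  have hv : volume.real (Set.Icc δ 1) = 1 - δ := by
    rw [Real.volume_real_Icc_of_le hδ1.le]
  have hL : ∀ τ ∈ Set.Ico 0 δ, τ ∉ Set.Icc δ 1 := fun τ h h' => absurd h.2 (not_lt.2 h'.1)
  have kL : ∀ x ∈ Set.Icc δ 1, ∀ τ ∈ Set.Ico 0 δ, ∑ i ∈ range 1,
      (Set.Icc δ 1).indicator (fun _ => if i = 0 then (√(1-δ))⁻¹ else 0) x *
      (Set.Icc δ 1).indicator (fun _ => if i = 0 then (√(1-δ))⁻¹ else 0) τ = 0 := by
    intro x hx τ hτ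
    rw [Finset.sum_range_one, Set.indicator_of_notMem (hL τ hτ), mul_zero]
  have kR : ∀ x ∈ Set.Icc δ 1, ∀ τ ∈ Set.Icc δ 1, ∑ i ∈ range 1,
      (Set.Icc δ 1).indicator (fun _ => if i = 0 then (√(1-δ))⁻¹ else 0) x *
      (Set.Icc δ 1).indicator (fun _ => if i = 0 then (√(1-δ))⁻¹ else 0) τ = EE δ ∅ x τ := by
    intro x hx τ hτ
    rw [Finset.sum_range_one, Set.indicator_of_mem hτ, Set.indicator_of_mem hx, EE, hc,
      Set.indicator_of_mem hτ, hv, if_pos rfl, hs]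
  refine ⟨fun i => measurable_const.indicator measurableSet_Icc, ?_, ?_, ?_, one_pos, by simp, ?_, ?_, kL, kR, ?_⟩
  · intro i x
    by_cases hx : x ∈ Set.Icc δ 1
    · rw [Set.indicator_of_mem hx]
      split_ifs
      · rw [abs_of_pos hs0]; linarith
      · rw [abs_zero]; positivity
    · rw [Set.indicator_of_notMem hx, abs_zero]; positivity
  · intro i hi j hj
    obtain rfl : i = 0 := by omega
    obtain rfl : j = 0 := by omega
    have : ∀ x, (Set.Icc δ 1).indicator (fun _ => if 0 = 0 then (√(1-δ))⁻¹ else 0) x *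
      (Set.Icc δ 1).indicator (fun _ => if 0 = 0 then (√(1-δ))⁻¹ else 0) x =
      (Set.Icc δ 1).indicator (fun _ => (1-δ)⁻¹) x := by
      intro x
      by_cases hx : x ∈ Set.Icc δ 1
      · simp only [Set.indicator_of_mem hx, if_true, hs]
      · simp only [Set.indicator_of_notMem hx, mul_zero]
    rw [integral_congr_ae (Eventually.of_forall this), ind_int hδ measurableSet_Icc subset_rfl, hv, mul_inv_cancel₀ hp.ne', if_pos rfl]
  · intro i x hx
    exact Set.indicator_of_notMem (fun h => hx ⟨hδ.le.trans h.1, h.2⟩) _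
  · intro i
    exact ⟨fun _ => 0, fun x hx => Set.indicator_of_notMem (hL x hx) _⟩
  · intro i x hx y hy
    beta_reduce
    rw [Set.indicator_of_mem hx, Set.indicator_of_mem hy.1]
  · intro x hx m hm
    rcases Nat.le_one_iff_eq_zero_or_eq_one.1 hm with rfl | rfl
    · simp
    · exact (ker_le hδ (kL x hx) (kR x hx)).trans (by norm_num)

/-- a stage of the construction -/
structure St (δ : ℝ) where
  n : ℕ
  g : ℕ → ℝ → ℝ
  N : ℕ
  D : Finset ℝ
  good : Good δ n g N D

lemma St.step {δ : ℝ} (hδ : 0 < δ) (hδ1 : δ < 1) (s : St δ) (r : ℕ × ℕ × ℚ) :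
    ∃ s' : St δ, s.n < s'.n ∧ (∀ i < s.n, s'.g i = s.g i) ∧ s.D ⊆ s'.D ∧
      ((r.2.2 : ℝ) ∈ Set.Ioo δ 1 → (r.2.2 : ℝ) ∈ s'.D) ∧
      (0 < r.1 → ∃ a : ℕ → ℝ, ∀ x, TT δ r.1 (fun j => if j = r.2.1 then 1 else 0) x =
        ∑ i ∈ range s'.n, a i * s'.g i x) := by
  obtain ⟨N0, k, q⟩ := r
  simp only
  have h1 : ∃ s1 : St δ, s.n ≤ s1.n ∧ (∀ i < s.n, s1.g i = s.g i) ∧ s.D = s1.D ∧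
      (0 < N0 → ∃ a : ℕ → ℝ, ∀ x, TT δ N0 (fun j => if j = k then 1 else 0) x =
        ∑ i ∈ range s1.n, a i * s1.g i x) := by
    by_cases hN0 : 0 < N0
    · obtain ⟨n', g', N', h1, h2, h3, h4⟩ := addL hδ hδ1 s.good hN0 (fun j => if j = k then 1 else 0) 1
        (fun j => by split_ifs <;> simp)
      exact ⟨⟨n', g', N', s.D, h1⟩, h2, h3, rfl, fun _ => h4⟩
    · exact ⟨s, le_rfl, fun _ _ => rfl, rfl, fun h => absurd h hN0⟩
  obtain ⟨s1, h1, h2, h3, h4⟩ := h1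
  have h5 : ∃ t ∈ Set.Ioo δ 1, t ∉ s1.D ∧ ((q : ℝ) ∈ Set.Ioo δ 1 → (q : ℝ) ∈ insert t s1.D) := by
    by_cases hq : (q : ℝ) ∈ Set.Ioo δ 1 ∧ (q : ℝ) ∉ s1.D
    · exact ⟨q, hq.1, hq.2, fun _ => Finset.mem_insert_self _ _⟩
    · obtain ⟨t, ht, ht'⟩ := (Set.Ioo_infinite hδ1).exists_notMem_finset s1.D
      refine ⟨t, ht, ht', fun h => Finset.mem_insert_of_mem ?_⟩
      by_contra h'
      exact hq ⟨h, h'⟩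
  obtain ⟨t, t1, t2, t3⟩ := h5
  obtain ⟨n', g', N', k1, k2, k3⟩ := splitR hδ hδ1 s1.good t1 t2
  refine ⟨⟨n', g', N', _, k1⟩, h1.trans_lt k2, fun i hi => (k3 i (hi.trans_le h1)).trans (h2 i hi),
    by rw [h3]; exact Finset.subset_insert _ _, t3, fun hN0 => ?_⟩
  obtain ⟨a, ha⟩ := h4 hN0
  refine ⟨fun i => if i < s1.n then a i else 0, fun x => ?_⟩
  rw [ha x, ← Finset.sum_subset (Finset.range_mono k2.le)]
  · refine Finset.sum_congr rfl fun i hi => ?_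
    have hi : i < s1.n := by simpa using hi
    simp only [if_pos hi, k3 i hi]
  · intro i _ hi
    have hi : ¬ i < s1.n := by simpa using hi
    simp only [if_neg hi, zero_mul]

lemma exists_seq {δ : ℝ} (hδ : 0 < δ) (hδ1 : δ < 1) :
    ∃ (s : ℕ → St δ) (ψ : ℕ → ℝ → ℝ), (∀ k, k ≤ (s k).n) ∧ (∀ k, ∀ i < (s k).n, ψ i = (s k).g i) ∧
      (∀ q : ℚ, (q : ℝ) ∈ Set.Ioo δ 1 → ∃ k, ∀ l ≥ k, (q : ℝ) ∈ (s l).D) ∧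
      (∀ N0 k, 0 < N0 → ∃ (n : ℕ) (a : ℕ → ℝ), ∀ x, TT δ N0 (fun j => if j = k then 1 else 0) x =
        ∑ i ∈ range n, a i * ψ i x) := by
  obtain ⟨e, he⟩ := exists_surjective_nat (ℕ × ℕ × ℚ)
  choose nx h1 h2 h3 h4 h5 using fun s r => St.step hδ hδ1 s r
  let s : ℕ → St δ := fun k => Nat.rec ⟨_, _, _, _, initGood hδ hδ1⟩ (fun k s => nx s (e k)) k
  have hs : ∀ k, s (k+1) = nx (s k) (e k) := fun k => rfl
  have hn : ∀ k, (s k).n < (s (k+1)).n := fun k => by rw [hs]; exact h1 _ _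
  have hmono : StrictMono fun k => (s k).n := strictMono_nat_of_lt_succ hn
  have hk : ∀ k, k ≤ (s k).n := fun k => hmono.le_apply
  have hag : ∀ k d, ∀ i < (s k).n, (s (k+d)).g i = (s k).g i := by
    intro k d i hi
    induction d with
    | zero => rfl
    | succ d ih =>
      rw [← add_assoc, hs, h2 _ _ _ (hi.trans_le (hmono.monotone (Nat.le_add_right k d))), ih]
  have hD : ∀ k l, k ≤ l → (s k).D ⊆ (s l).D := by
    have : Monotone fun k => (s k).D := monotone_nat_of_le_succ fun k => by
      rw [hs]; exact h3 _ _
    exact fun k l h => this h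
  have hψ : ∀ k, ∀ i < (s k).n, (s (i+1)).g i = (s k).g i := by
    intro k i hi
    rw [← hag k (i+1) i hi, add_comm k, hag (i+1) k i (hk (i+1))]
  refine ⟨s, fun i => (s (i+1)).g i, hk, hψ, ?_, ?_⟩
  · intro q hq
    obtain ⟨m, hm⟩ := he (0, 0, q)
    refine ⟨m+1, fun l hl => hD _ _ hl ?_⟩
    rw [hs, hm]
    exact h4 _ (0, 0, q) hq
  · intro N0 k hN0
    obtain ⟨m, hm⟩ := he (N0, k, 0)
    obtain ⟨a, ha⟩ := h5 (s m) (N0, k, 0) hN0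
    refine ⟨(s (m+1)).n, a, fun x => ?_⟩
    rw [ha x, hs, hm]
    refine Finset.sum_congr rfl fun i hi => ?_
    have h := hψ (m+1) i (by rw [hs, hm]; simpa using hi)
    beta_reduce
    rw [h, hs, hm]

lemma cell_small {δ : ℝ} {η : ℝ} (hη : 0 < η) :
    ∃ Q : Finset ℚ, ∀ D : Finset ℝ, (∀ q ∈ Q, (q : ℝ) ∈ Set.Ioo δ 1 → (q : ℝ) ∈ D) →
      ∀ x ∈ Set.Icc δ 1, ∀ y ∈ cell δ D x, 0 ≤ x → 0 ≤ y → |x - y| < η := by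
  obtain ⟨m, hm⟩ := exists_nat_one_div_lt hη
  have hm0 : (0:ℝ) < m + 1 := by positivity
  refine ⟨(range (m+2)).image fun j : ℕ => (j : ℚ) / (m+1), fun D hD => ?_⟩
  have key : ∀ x y, x ∈ Set.Icc δ 1 → y ∈ cell δ D x → 0 ≤ x → x < y → y - x < η := by
    intro x y hx hy hx0 hxy
    by_contra h
    push Not at h
    set j := ⌊x * (m+1)⌋₊ + 1 with hj
    have e1 : x < (j:ℝ) / (m+1) := by
      rw [lt_div_iff₀ hm0, hj]; push_cast; exact Nat.lt_floor_add_one _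
    have e2 : (j:ℝ) / (m+1) ≤ x + 1 / (m+1) := by
      rw [div_le_iff₀ hm0, add_mul, one_div_mul_cancel hm0.ne', hj]; push_cast
      have := Nat.floor_le (show 0 ≤ x * (m+1) by positivity)
      linarith
    have e3 : (j:ℝ) / (m+1) < y := by linarith
    have e4 : (j:ℝ) / (m+1) < 1 := e3.trans_le hy.1.2
    have hjm : j < m + 2 := by
      rw [div_lt_one hm0] at e4
      have : j < m + 1 := by exact_mod_cast e4
      omega
    have hc : (((j:ℚ) / (m+1) : ℚ) : ℝ) = (j:ℝ) / (m+1) := by push_cast; rfl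
    have hin := hD _ (Finset.mem_image_of_mem _ (Finset.mem_range.2 hjm)) (by
      rw [hc]; exact ⟨hx.1.trans_lt e1, e4⟩)
    rw [hc] at hin
    exact absurd ((hy.2 _ hin).2 e3.le) (not_le.2 e1)
  intro x hx y hy hx0 hy0
  rcases lt_trichotomy x y with h | h | h
  · rw [abs_sub_comm, abs_of_pos (by linarith)]; exact key x y hx hy hx0 h
  · rw [h, sub_self, abs_zero]; exact hη
  · rw [abs_of_pos (by linarith)]; exact key y x hy.1 (cell_symm hx hy) hy0 h

lemma span_form {ψ : ℕ → ℝ → ℝ} {h : ℝ → ℝ} (hh : h ∈ Submodule.span ℝ (Set.range ψ)) :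
    ∃ (N : ℕ) (a : ℕ → ℝ), ∀ x, h x = ∑ n ∈ range N, a n * ψ n x := by
  obtain ⟨c, rfl⟩ := Finsupp.mem_span_range_iff_exists_finsupp.1 hh
  refine ⟨c.support.sup id + 1, c, fun x => ?_⟩
  rw [Finsupp.sum, Finset.sum_apply]
  simp only [Pi.smul_apply, smul_eq_mul]
  refine Finset.sum_subset (fun i hi => ?_) fun i _ hi => ?_
  · rw [Finset.mem_range, Nat.lt_succ_iff]; exact Finset.le_sup (f := id) hi
  · rw [Finsupp.notMem_support_iff.1 hi, zero_mul]

lemma sum_span {ψ : ℕ → ℝ → ℝ} (n : ℕ) (a : ℕ → ℝ) :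
    (fun x => ∑ i ∈ range n, a i * ψ i x) ∈ Submodule.span ℝ (Set.range ψ) := by
  have : (fun x => ∑ i ∈ range n, a i * ψ i x) = ∑ i ∈ range n, a i • ψ i := by
    ext x; simp [Finset.sum_apply]
  rw [this]
  exact Submodule.sum_mem _ fun i _ => Submodule.smul_mem _ _ (Submodule.subset_span ⟨i, rfl⟩)

lemma TT_split {δ : ℝ} (hδ : 0 < δ) {N : ℕ} (hN : 0 < N) (c : ℕ → ℝ) :
    TT δ N c = ∑ k ∈ range N, c k • TT δ N (fun j => if j = k then 1 else 0) := by
  symm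
  apply TT_ext
  · intro x hx
    rw [Finset.sum_apply]
    simp only [Pi.smul_apply, smul_eq_mul, TT_in hx, mul_ite, mul_one, mul_zero]
    rw [Finset.sum_ite_eq, if_pos (Finset.mem_range.2 (TT_floor_lt hδ hN hx))]
  · intro x hx
    rw [Finset.sum_apply]
    simp only [Pi.smul_apply, smul_eq_mul, TT_out hx, mul_zero, Finset.sum_const_zero]

lemma right_approx {δ : ℝ} (hδ : 0 < δ) (hδ1 : δ < 1) {n : ℕ} {g : ℕ → ℝ → ℝ} {N : ℕ} {D : Finset ℝ}
    (hg : Good δ n g N D) {f : ℝ → ℝ} (hf : ContinuousOn f (Set.Icc (0:ℝ) 1)) {e : ℝ}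
    (he : ∀ x ∈ Set.Icc δ 1, ∀ y ∈ cell δ D x, |f y - f x| ≤ e) :
    ∃ a : ℕ → ℝ, (∀ x ∈ Set.Ico 0 δ, ∑ i ∈ range n, a i * g i x = 0) ∧
      ∀ x ∈ Set.Icc δ 1, |f x - ∑ i ∈ range n, a i * g i x| ≤ e := by
  have hsub : Set.Icc δ 1 ⊆ Set.Icc (0:ℝ) 1 := Set.Icc_subset_Icc_left hδ.le
  have hfi : IntegrableOn f (Set.Icc δ 1) := (hf.mono hsub).integrableOn_Icc
  have hgi : ∀ i, IntegrableOn (fun τ => g i τ * f τ) (Set.Icc δ 1) := fun i =>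
    hfi.bdd_mul (hg.meas i).aestronglyMeasurable (Eventually.of_forall (hg.bdd i))
  have hsum : ∀ x, ∑ i ∈ range n, (∫ τ in Set.Icc δ 1, g i τ * f τ) * g i x =
      ∫ τ in Set.Icc δ 1, (∑ i ∈ range n, g i x * g i τ) * f τ := by
    intro x
    simp_rw [Finset.sum_mul, mul_assoc]
    rw [integral_finsetSum _ fun i _ => (hgi i).const_mul _]
    refine Finset.sum_congr rfl fun i _ => ?_
    rw [integral_const_mul, mul_comm]
  refine ⟨fun i => ∫ τ in Set.Icc δ 1, g i τ * f τ, fun x hx => ?_, fun x hx => ?_⟩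
  · rw [hsum]
    rw [setIntegral_congr_fun (g := fun _ => (0:ℝ)) measurableSet_Icc, integral_zero]
    intro τ hτ
    have := hg.kerL τ hτ x hx
    simp_rw [mul_comm (g _ τ)] at this
    simp only [this, zero_mul]
  · have hv := cell_pos hδ1 hg.Dsub hx
    set V := volume.real (cell δ D x) with hV
    have e1 : ∑ i ∈ range n, (∫ τ in Set.Icc δ 1, g i τ * f τ) * g i x = V⁻¹ * ∫ τ in cell δ D x, f τ := by
      rw [hsum, setIntegral_congr_fun (g := (cell δ D x).indicator fun τ => V⁻¹ * f τ) measurableSet_Icc]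
      · rw [integral_indicator (cell_meas _ _ _), Measure.restrict_restrict (cell_meas _ _ _),
          Set.inter_eq_left.2 (cell_sub _ _ _), integral_const_mul]
      · intro τ hτ
        simp only [hg.kerR x hx τ hτ, EE]
        by_cases h : τ ∈ cell δ D x
        · simp only [Set.indicator_of_mem h, hV]
        · simp only [Set.indicator_of_notMem h, zero_mul]
    have hfin : volume (cell δ D x) < ⊤ := by
      have := cell_fin δ D x Set.univ
      rw [Set.inter_univ] at this
      exact lt_top_iff_ne_top.2 this
    have e2 : ∫ τ in cell δ D x, (f τ - f x) = (∫ τ in cell δ D x, f τ) - V * f x := by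
      rw [integral_sub (hfi.mono_set (cell_sub _ _ _)) (integrableOn_const hfin.ne), setIntegral_const, smul_eq_mul]
    have e3 := norm_setIntegral_le_of_norm_le_const (f := fun τ => f τ - f x) hfin (he x hx)
    rw [e2, Real.norm_eq_abs, ← hV] at e3
    rw [e1]
    have e4 : f x - V⁻¹ * ∫ τ in cell δ D x, f τ = -(V⁻¹ * ((∫ τ in cell δ D x, f τ) - V * f x)) := by
      field_simp; ring
    rw [e4, abs_neg, abs_mul, abs_of_pos (inv_pos.2 hv), inv_mul_le_iff₀ hv]
    linarith

/-- Olevskii: for every `0 < δ < 1` there exists an orthonormal system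
`{ψ_n}` of real-valued functions in `L²[0,1]` that is closed in `C[0,1]`, uniformly
bounded in `L^∞[0,1]`, and such that for some constant `C₇`,
`∫₀¹ |∑_{n=1}^N ψ_n(x) ψ_n(τ)| dτ ≤ C₇` for all `x ∈ [δ,1]` and all `N`. -/
theorem stmt7 (δ : ℝ) (hδ0 : 0 < δ) (hδ1 : δ < 1) :
    ∃ ψ : ℕ → ℝ → ℝ,
      (∀ n, Measurable (ψ n)) ∧
      -- orthonormality in L²[0,1]
      (∀ n m : ℕ, (∫ x in Set.Icc (0 : ℝ) 1, ψ n x * ψ m x) = if n = m then 1 else 0) ∧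
      -- closedness in C[0,1]
      (∀ f : ℝ → ℝ, ContinuousOn f (Set.Icc (0 : ℝ) 1) → ∀ ε : ℝ, 0 < ε →
        ∃ (N : ℕ) (a : ℕ → ℝ),
          ∀ x ∈ Set.Icc (0 : ℝ) 1, |f x - ∑ n ∈ Finset.range N, a n * ψ n x| < ε) ∧
      -- uniform boundedness
      (∃ B : ℝ, ∀ n, ∀ x ∈ Set.Icc (0 : ℝ) 1, |ψ n x| ≤ B) ∧
      -- uniform integral bound on [δ,1]
      (∃ C₇ : ℝ, ∀ x ∈ Set.Icc δ 1, ∀ N : ℕ,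
        (∫ τ in Set.Icc (0 : ℝ) 1, |∑ n ∈ Finset.range N, ψ n x * ψ n τ|) ≤ C₇) := by
  obtain ⟨s, ψ, hk, hψ, hq, hT⟩ := exists_seq hδ0 hδ1
  have hψ' : ∀ i, ψ i = (s (i+1)).g i := fun i => hψ (i+1) i (hk (i+1))
  refine ⟨ψ, ?_, ?_, ?_, ⟨1 + (√δ)⁻¹ + (√(1-δ))⁻¹, ?_⟩, ⟨2, ?_⟩⟩
  · intro i; rw [hψ']; exact (s (i+1)).good.meas i
  · intro i j
    have hi : i < (s (max i j + 1)).n := by have := hk (max i j + 1); omega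
    have hj : j < (s (max i j + 1)).n := by have := hk (max i j + 1); omega
    rw [hψ _ i hi, hψ _ j hj]
    exact (s _).good.orth i hi j hj
  · intro f hf ε hε
    have huc := isCompact_Icc.uniformContinuousOn_of_continuous hf
    rw [Metric.uniformContinuousOn_iff] at huc
    obtain ⟨η, hη, huc⟩ := huc (ε/2) (by positivity)
    obtain ⟨Q, hQ⟩ := cell_small (δ := δ) hη
    have hstage : ∃ k, ∀ q ∈ Q, (q : ℝ) ∈ Set.Ioo δ 1 → (q : ℝ) ∈ (s k).D := by
      have : ∀ q : ℚ, ∃ k, (q : ℝ) ∈ Set.Ioo δ 1 → ∀ l ≥ k, (q : ℝ) ∈ (s l).D := by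
        intro q
        by_cases h : (q : ℝ) ∈ Set.Ioo δ 1
        · obtain ⟨k, hk⟩ := hq q h
          exact ⟨k, fun _ => hk⟩
        · exact ⟨0, fun h' => absurd h' h⟩
      choose K hK using this
      exact ⟨Q.sup K, fun q hq h => hK q h _ (Finset.le_sup hq)⟩
    obtain ⟨k, hk'⟩ := hstage
    have hsub : Set.Icc δ 1 ⊆ Set.Icc (0:ℝ) 1 := Set.Icc_subset_Icc_left hδ0.le
    obtain ⟨a, a1, a2⟩ := right_approx hδ0 hδ1 (s k).good hf (e := ε/2) (by
      intro x hx y hy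
      have h := hQ _ hk' x hx y hy (hsub hx).1 (hsub hy.1).1
      have := huc y (hsub hy.1) x (hsub hx) (by rw [Real.dist_eq, abs_sub_comm]; exact h)
      rw [Real.dist_eq] at this
      exact this.le)
    obtain ⟨m, hm⟩ := exists_nat_one_div_lt (show 0 < η / δ by positivity)
    have hm0 : (0:ℝ) < m + 1 := by positivity
    have hmη : δ / (m+1) < η := by
      rw [lt_div_iff₀ hδ0] at hm
      calc δ / (m+1) = 1 / (m+1) * δ := by ring
        _ < η := hm
    set c : ℕ → ℝ := fun j => f (j * (δ / (m+1))) with hc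
    have hr : (fun x => ∑ i ∈ range (s k).n, a i * ψ i x) = fun x => ∑ i ∈ range (s k).n, a i * (s k).g i x := by
      ext x
      exact Finset.sum_congr rfl fun i hi => by rw [hψ k i (by simpa using hi)]
    have hspan : TT δ (m+1) c + (fun x => ∑ i ∈ range (s k).n, a i * ψ i x) ∈ Submodule.span ℝ (Set.range ψ) := by
      refine Submodule.add_mem _ ?_ (sum_span _ _)
      rw [TT_split hδ0 (Nat.succ_pos m)]
      refine Submodule.sum_mem _ fun j _ => Submodule.smul_mem _ _ ?_
      obtain ⟨n, b, hb⟩ := hT (m+1) j (Nat.succ_pos m)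
      rw [funext hb]
      exact sum_span _ _
    obtain ⟨M, b, hb⟩ := span_form hspan
    refine ⟨M, b, fun x hx => ?_⟩
    rw [← hb x, Pi.add_apply, congrFun hr x]
    by_cases hxδ : x < δ
    · have hx' : x ∈ Set.Ico 0 δ := ⟨hx.1, hxδ⟩
      beta_reduce
      rw [a1 x hx', add_zero, TT_in hx']
      simp only [hc]
      set j := ⌊((m+1 : ℕ):ℝ) * x / δ⌋₊ with hj
      have j1 : (j:ℝ) ≤ ((m+1 : ℕ):ℝ) * x / δ := Nat.floor_le (by have := hx.1; positivity)
      have j2 : ((m+1 : ℕ):ℝ) * x / δ < j + 1 := Nat.lt_floor_add_one _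
      push_cast at j1 j2
      have hu : 0 < δ / (m+1) := by positivity
      have hxe : (m+1) * x / δ * (δ / (m+1)) = x := by field_simp
      have j3 : (j:ℝ) * (δ / (m+1)) ≤ x := by
        have := mul_le_mul_of_nonneg_right j1 hu.le
        rwa [hxe] at this
      have j4 : x < (j:ℝ) * (δ / (m+1)) + δ / (m+1) := by
        have := mul_lt_mul_of_pos_right j2 hu
        rw [hxe] at this
        linarith
      have := huc x hx (j * (δ / (m+1))) ⟨by positivity, j3.trans hx.2⟩ (by
        rw [Real.dist_eq, abs_of_nonneg (by linarith)]; linarith)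
      rw [Real.dist_eq] at this
      linarith
    · have hx' : x ∈ Set.Icc δ 1 := ⟨not_lt.1 hxδ, hx.2⟩
      rw [TT_out (fun h => hxδ h.2), zero_add]
      exact (a2 x hx').trans_lt (by linarith)
  · intro i x _
    rw [hψ']; exact (s (i+1)).good.bdd i x
  · intro x hx N
    have : ∀ τ, ∑ n ∈ range N, ψ n x * ψ n τ = ∑ n ∈ range N, (s N).g n x * (s N).g n τ := fun τ =>
      Finset.sum_congr rfl fun i hi => by
        rw [hψ N i ((Finset.mem_range.1 hi).trans_le (hk N))]
    simp_rw [this]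
    exact (s N).good.leb x hx N (hk N)
end

section
/- Let {ĝ_n}_{n∈ℕ} ⊂ C[−π,π] satisfy: (i) sup_n ‖ĝ_n‖_{L^∞[−π,π]} < ∞ and inf_n ‖ĝ_n‖_{L^∞[−π,π]} > 0; (ii) {ĝ_n} is closed in C[−π,π] (finite linear combinations are uniformly dense) and minimal (no ĝ_m lies in the closed linear span of {ĝ_n}_{n≠m}); (iii) there is C₁₃ > 0 with ‖Σ_n a_n ĝ_n‖_{L^∞[−π,π]} ≥ C₁₃^{−1} (Σ_n |a_n|²)^{1/2} for all finite scalar sequences {a_n}. Let {u_n}_{n∈ℕ} be the unique sequence of continuous linear functionals on C[−π,π] biorthogonal to {ĝ_n} (u_n(ĝ_m) = δ_{nm}), and for ĥ ∈ C[−π,π] and t ∈ ℝ set w_n(ĥ, t) = u_n(ω ↦ ĥ(ω) e^{iωt}) and, for f ∈ PW¹_π, c_n(f, t) = (1/(2π)) ∫_{−π}^{π} f̂(ω) ĝ_n(ω) e^{iωt} dω. Then for every t ∈ ℝ there exist ĥ_{*1} ∈ C[−π,π] and f_{*1} ∈ PW¹_π such that limsup_{N→∞} | Σ_{n=1}^{N}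 c_n(f_{*1}, t) w_n(ĥ_{*1}, 0) | = ∞. -/
open MeasureTheory Filter Finset

/-- Evaluation of a continuous function on `[-π,π]` at a real point (via the projection
onto `[-π,π]`; for `ω ∈ [-π,π]` this is just evaluation at `ω`). -/
noncomputable def evalR (g : C(↥(Set.Icc (-Real.pi) Real.pi), ℂ)) (ω : ℝ) : ℂ :=
  g (Set.projIcc (-Real.pi) Real.pi (by linarith [Real.pi_pos]) ω)

/-- The continuous function `ω ↦ e^{iωt}` on `[-π,π]`. -/
noncomputable def expCM (t : ℝ) : C(↥(Set.Icc (-Real.pi) Real.pi), ℂ) :=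
  ⟨fun ω => Complex.exp (Complex.I * ((ω : ℝ) : ℂ) * (t : ℂ)), by fun_prop⟩


section Helpers

open scoped NNReal CompactlySupported

/-- values `‖u h‖` with `|h| ≤ f` -/
def domSet {K : Type*} [TopologicalSpace K] [CompactSpace K]
    (u : C(K, ℂ) →L[ℂ] ℂ) (f : K → ℝ≥0) : Set ℝ :=
  {r | ∃ h : C(K, ℂ), (∀ x, ‖h x‖ ≤ f x) ∧ r = ‖u h‖}

lemma domSet_bdd {K : Type*} [TopologicalSpace K] [CompactSpace K]
    (u : C(K, ℂ) →L[ℂ] ℂ) (f : K → ℝ≥0) (hf : Continuous f) : BddAbove (domSet u f) := by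
  obtain ⟨M, hM⟩ := (isCompact_range hf).bddAbove
  refine ⟨‖u‖ * M, ?_⟩
  rintro r ⟨h, hh, rfl⟩
  refine (u.le_opNorm h).trans ?_
  gcongr
  refine (ContinuousMap.norm_le _ M.2).2 fun x => (hh x).trans ?_
  exact_mod_cast hM ⟨x, rfl⟩

lemma domSet_zero_mem {K : Type*} [TopologicalSpace K] [CompactSpace K]
    (u : C(K, ℂ) →L[ℂ] ℂ) (f : K → ℝ≥0) : (0 : ℝ) ∈ domSet u f :=
  ⟨0, by simp, by simp⟩

lemma domSet_sSup_nonneg {K : Type*} [TopologicalSpace K] [CompactSpace K]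
    (u : C(K, ℂ) →L[ℂ] ℂ) (f : K → ℝ≥0) (hf : Continuous f) : 0 ≤ sSup (domSet u f) :=
  le_csSup (domSet_bdd u f hf) (domSet_zero_mem u f)

lemma domSet_add {K : Type*} [TopologicalSpace K] [CompactSpace K]
    (u : C(K, ℂ) →L[ℂ] ℂ) (f g : K → ℝ≥0) (hf : Continuous f) (hg : Continuous g) :
    sSup (domSet u (f + g)) = sSup (domSet u f) + sSup (domSet u g) := by
  apply le_antisymm
  · refine csSup_le ⟨_, domSet_zero_mem u _⟩ ?_
    rintro r ⟨h, hh, rfl⟩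
    refine le_of_forall_pos_le_add fun η hη => ?_
    obtain ⟨ε, hε, hεη⟩ : ∃ ε > 0, ‖u‖ * ε ≤ η := by
      refine ⟨η / (‖u‖ + 1), by positivity, ?_⟩
      rw [mul_div_assoc', div_le_iff₀ (by positivity)]
      nlinarith [norm_nonneg u]
    have hden : ∀ x, ((f x : ℝ) + g x + ε : ℂ) ≠ 0 := by
      intro x
      have : (0:ℝ) < (f x : ℝ) + g x + ε := by positivity
      exact_mod_cast this.ne'
    have hdn : ∀ x, ‖((f x : ℝ) + g x + ε : ℂ)‖ = (f x : ℝ) + g x + ε := by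
      intro x
      have : (0:ℝ) ≤ (f x : ℝ) + g x + ε := by positivity
      rw [← Complex.ofReal_add, ← Complex.ofReal_add, Complex.norm_real, Real.norm_of_nonneg this]
    let h1 : C(K, ℂ) := ⟨fun x => h x * ((f x : ℝ) : ℂ) / ((f x : ℝ) + g x + ε : ℂ), by
      refine Continuous.div (by fun_prop) (by fun_prop) hden⟩
    let h2 : C(K, ℂ) := ⟨fun x => h x * ((g x : ℝ) : ℂ) / ((f x : ℝ) + g x + ε : ℂ), by
      refine Continuous.div (by fun_prop) (by fun_prop) hden⟩
    have hh' : ∀ x, ‖h x‖ ≤ (f x : ℝ) + g x := by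
      intro x; simpa using hh x
    have e1 : ‖u h1‖ ≤ sSup (domSet u f) := by
      refine le_csSup (domSet_bdd u f hf) ⟨h1, fun x => ?_, rfl⟩
      change ‖h x * ((f x : ℝ) : ℂ) / ((f x : ℝ) + g x + ε : ℂ)‖ ≤ _
      rw [norm_div, hdn, norm_mul, div_le_iff₀ (by positivity)]
      simp only [Complex.norm_real, Real.norm_eq_abs, NNReal.abs_eq]
      nlinarith [hh' x, (f x).2]
    have e2 : ‖u h2‖ ≤ sSup (domSet u g) := by
      refine le_csSup (domSet_bdd u g hg) ⟨h2, fun x => ?_, rfl⟩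
      change ‖h x * ((g x : ℝ) : ℂ) / ((f x : ℝ) + g x + ε : ℂ)‖ ≤ _
      rw [norm_div, hdn, norm_mul, div_le_iff₀ (by positivity)]
      simp only [Complex.norm_real, Real.norm_eq_abs, NNReal.abs_eq]
      nlinarith [hh' x, (g x).2]
    have e3 : ‖u (h - (h1 + h2))‖ ≤ η := by
      refine (u.le_opNorm _).trans (le_trans ?_ hεη)
      gcongr
      refine (ContinuousMap.norm_le _ hε.le).2 fun x => ?_
      have : (h - (h1 + h2)) x = h x * ε / ((f x : ℝ) + g x + ε : ℂ) := by
        change h x - (h x * ((f x : ℝ) : ℂ) / ((f x : ℝ) + g x + ε : ℂ) +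
          h x * ((g x : ℝ) : ℂ) / ((f x : ℝ) + g x + ε : ℂ)) = _
        have := hden x
        field_simp
        ring
      rw [this, norm_div, hdn, norm_mul, div_le_iff₀ (by positivity)]
      simp only [Complex.norm_real, Real.norm_eq_abs, abs_of_pos hε]
      nlinarith [hh' x]
    calc ‖u h‖ = ‖u h1 + u h2 + u (h - (h1 + h2))‖ := by
          rw [← map_add, ← map_add]; congr 2; abel
      _ ≤ ‖u h1‖ + ‖u h2‖ + ‖u (h - (h1 + h2))‖ := norm_add₃_le
      _ ≤ _ := by linarith
  · have hsup : ∀ h1 h2 : C(K, ℂ), (∀ x, ‖h1 x‖ ≤ f x) → (∀ x, ‖h2 x‖ ≤ g x) →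
        ‖u h1‖ + ‖u h2‖ ≤ sSup (domSet u (f + g)) := by
      intro h1 h2 H1 H2
      have hrot : ∀ z : ℂ, ∃ c : ℂ, ‖c‖ ≤ 1 ∧ c * z = ‖z‖ := by
        intro z
        by_cases hz : z = 0
        · exact ⟨0, by simp, by simp [hz]⟩
        · refine ⟨(‖z‖ : ℂ) / z, ?_, by field_simp⟩
          rw [norm_div]; simp [hz]
      obtain ⟨c1, hc1, hc1'⟩ := hrot (u h1)
      obtain ⟨c2, hc2, hc2'⟩ := hrot (u h2)
      refine le_csSup (domSet_bdd u _ (hf.add hg)) ⟨c1 • h1 + c2 • h2, fun x => ?_, ?_⟩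
      · have a1 : ‖c1 * h1 x‖ ≤ f x := by
          rw [norm_mul]; nlinarith [H1 x, norm_nonneg (h1 x), norm_nonneg c1]
        have a2 : ‖c2 * h2 x‖ ≤ g x := by
          rw [norm_mul]; nlinarith [H2 x, norm_nonneg (h2 x), norm_nonneg c2]
        simpa using (norm_add_le _ _).trans (add_le_add a1 a2)
      · rw [map_add, map_smul, map_smul, smul_eq_mul, smul_eq_mul, hc1', hc2',
          ← Complex.ofReal_add, Complex.norm_real, Real.norm_of_nonneg (by positivity)]
    have : sSup (domSet u f) ≤ sSup (domSet u (f + g)) - sSup (domSet u g) := by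
      refine csSup_le ⟨_, domSet_zero_mem u _⟩ ?_
      rintro r ⟨h1, H1, rfl⟩
      have : sSup (domSet u g) ≤ sSup (domSet u (f + g)) - ‖u h1‖ := by
        refine csSup_le ⟨_, domSet_zero_mem u _⟩ ?_
        rintro r ⟨h2, H2, rfl⟩
        linarith [hsup h1 h2 H1 H2]
      linarith
    linarith

lemma domSet_smul_le {K : Type*} [TopologicalSpace K] [CompactSpace K]
    (u : C(K, ℂ) →L[ℂ] ℂ) (f : K → ℝ≥0) (hf : Continuous f) (c : ℝ≥0) (hc : c ≠ 0) :
    c * sSup (domSet u f) ≤ sSup (domSet u (c • f)) := by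
  have hc' : (0:ℝ) < c := by positivity
  rw [mul_comm, ← le_div_iff₀ hc']
  refine csSup_le ⟨_, domSet_zero_mem u _⟩ ?_
  rintro r ⟨h, hh, rfl⟩
  rw [le_div_iff₀ hc']
  refine le_csSup (domSet_bdd u _ (hf.const_smul c)) ⟨(c : ℂ) • h, fun x => ?_, ?_⟩
  · simpa using mul_le_mul_of_nonneg_left (hh x) hc'.le
  · simp [mul_comm]

lemma domSet_smul {K : Type*} [TopologicalSpace K] [CompactSpace K]
    (u : C(K, ℂ) →L[ℂ] ℂ) (f : K → ℝ≥0) (hf : Continuous f) (c : ℝ≥0) :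
    sSup (domSet u (c • f)) = c * sSup (domSet u f) := by
  by_cases hc : c = 0
  · subst hc
    have := domSet_add u 0 0 continuous_const continuous_const
    simp at this
    simp [this]
  · apply le_antisymm _ (domSet_smul_le u f hf c hc)
    have := domSet_smul_le u (c • f) (hf.const_smul c) c⁻¹ (by simpa using hc)
    rw [smul_smul, inv_mul_cancel₀ hc, one_smul] at this
    have hc' : (0:ℝ) < c := by positivity
    push_cast at this
    rw [inv_mul_le_iff₀ hc'] at this
    exact this

/-- A bounded functional on `C(K)` is dominated by a finite measure. -/
lemma exists_dominating {K : Type*} [TopologicalSpace K] [CompactSpace K] [T2Space K]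
    [MeasurableSpace K] [BorelSpace K] (u : C(K, ℂ) →L[ℂ] ℂ) :
    ∃ μ : Measure K, IsFiniteMeasure μ ∧ μ Set.univ ≤ ENNReal.ofReal ‖u‖ ∧
      ∀ h : C(K, ℂ), ‖u h‖ ≤ ∫ x, ‖h x‖ ∂μ := by
  let Λ : C_c(K, ℝ≥0) →ₗ[ℝ≥0] ℝ≥0 :=
    { toFun := fun f => ⟨sSup (domSet u f), domSet_sSup_nonneg u f f.continuous⟩
      map_add' := fun f g => by
        apply NNReal.eq
        exact domSet_add u f g f.continuous g.continuous
      map_smul' := fun c f => by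
        apply NNReal.eq
        exact domSet_smul u f f.continuous c }
  have hΛ : ∀ f, (Λ f : ℝ) = sSup (domSet u f) := fun f => rfl
  let one : C_c(K, ℝ≥0) := CompactlySupportedContinuousMap.continuousMapEquiv 1
  have huniv : NNRealRMK.rieszMeasure Λ Set.univ ≤ ENNReal.ofReal ‖u‖ := by
    have h1 := NNRealRMK.lintegral_rieszMeasure Λ one
    have h2 : ∫⁻ x, (one x : ENNReal) ∂(NNRealRMK.rieszMeasure Λ)
        = NNRealRMK.rieszMeasure Λ Set.univ := by
      simp [one]
    rw [← h2, h1]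
    rw [← ENNReal.ofReal_coe_nnreal, hΛ]
    apply ENNReal.ofReal_le_ofReal
    refine csSup_le ⟨_, domSet_zero_mem u _⟩ ?_
    rintro r ⟨h, hh, rfl⟩
    refine (u.le_opNorm h).trans ?_
    have : ‖h‖ ≤ 1 := (ContinuousMap.norm_le _ zero_le_one).2 fun x => by simpa [one] using hh x
    nlinarith [norm_nonneg u]
  refine ⟨NNRealRMK.rieszMeasure Λ, ⟨lt_of_le_of_lt huniv ENNReal.ofReal_lt_top⟩, huniv, ?_⟩
  intro h
  let f : C_c(K, ℝ≥0) := CompactlySupportedContinuousMap.continuousMapEquiv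
    ⟨fun x => ‖h x‖₊, by fun_prop⟩
  have := NNRealRMK.integral_rieszMeasure Λ f
  have e : ∫ x, ‖h x‖ ∂(NNRealRMK.rieszMeasure Λ) = ∫ x, (f x : ℝ) ∂(NNRealRMK.rieszMeasure Λ) := rfl
  rw [e, this, hΛ]
  exact le_csSup (domSet_bdd u f f.continuous) ⟨h, fun x => le_rfl, rfl⟩

lemma exists_dominating_seq {K : Type*} [TopologicalSpace K] [CompactSpace K] [T2Space K]
    [MeasurableSpace K] [BorelSpace K] (u : ℕ → C(K, ℂ) →L[ℂ] ℂ) (C : ℝ) (hC : ∀ n, ‖u n‖ ≤ C) :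
    ∃ μ : Measure K, IsFiniteMeasure μ ∧
      ∀ n, ∀ h : C(K, ℂ), ‖u n h‖ ≤ 2 ^ n * ∫ x, ‖h x‖ ∂μ := by
  choose μ hfin hμ hd using fun n => exists_dominating (u n)
  let c : ℕ → ENNReal := fun n => (2⁻¹ : ENNReal) ^ n
  let ν : Measure K := Measure.sum fun n => c n • μ n
  have hν : IsFiniteMeasure ν := by
    constructor
    rw [Measure.sum_apply _ MeasurableSet.univ]
    calc ∑' n, (c n • μ n) Set.univ ≤ ∑' n, c n * ENNReal.ofReal C := by
          refine ENNReal.tsum_le_tsum fun n => ?_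
          rw [Measure.smul_apply, smul_eq_mul]
          gcongr
          exact (hμ n).trans (ENNReal.ofReal_le_ofReal (hC n))
      _ = 2 * ENNReal.ofReal C := by
          rw [ENNReal.tsum_mul_right, ENNReal.tsum_geometric]
          simp
      _ < ⊤ := ENNReal.mul_lt_top (by simp) ENNReal.ofReal_lt_top
  refine ⟨ν, hν, fun n h => (hd n h).trans ?_⟩
  have hle : c n • μ n ≤ ν := Measure.le_sum (fun n => c n • μ n) n
  have hInteg : ∀ (m : Measure K) [IsFiniteMeasure m], Integrable (fun x => ‖h x‖) m := fun m _ =>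
    Continuous.integrable_of_hasCompactSupport (by fun_prop) (HasCompactSupport.of_compactSpace _)
  have := integral_mono_measure hle (Eventually.of_forall fun x => norm_nonneg (h x)) (hInteg ν)
  rw [integral_smul_measure] at this
  have hc : (c n).toReal = (2 ^ n : ℝ)⁻¹ := by simp [c]
  rw [hc, smul_eq_mul, inv_mul_le_iff₀ (by positivity)] at this
  exact this

open scoped Topology ComplexConjugate

lemma exists_density {K : Type*} [PseudoMetricSpace K] [CompactSpace K]
    [MeasurableSpace K] [BorelSpace K] (μ : Measure K) [IsFiniteMeasure μ]
    (u : C(K, ℂ) →L[ℂ] ℂ) (c : ℝ) (hc : 0 ≤ c) (hu : ∀ h : C(K, ℂ), ‖u h‖ ≤ c * ∫ x, ‖h x‖ ∂μ) :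
    ∃ φ : K → ℂ, Measurable φ ∧ Integrable φ μ ∧ ∀ h : C(K, ℂ), u h = ∫ x, φ x * h x ∂μ := by
  have hdense := ContinuousMap.toLp_denseRange ℂ μ ℂ (p := 2) (by simp)
  let e : C(K, ℂ) →L[ℂ] Lp ℂ 2 μ := ContinuousMap.toLp 2 μ ℂ
  have hnorm : ∃ C, ∀ h : C(K, ℂ), ‖u.toLinearMap h‖ ≤ C * ‖e.toLinearMap h‖ := by
    refine ⟨c * (μ Set.univ ^ (1 / (1:ENNReal).toReal - 1 / (2:ENNReal).toReal)).toReal,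
      fun h => (hu h).trans ?_⟩
    rw [mul_assoc]
    gcongr
    have h2 : MemLp h 2 μ := h.memLp (p := 2) (μ := μ) ℂ
    have h1 : Integrable h μ := h2.integrable (by norm_num)
    have hle := eLpNorm_le_eLpNorm_mul_rpow_measure_univ (μ := μ) (p := 1) (q := 2) (f := h)
      (by norm_num) h2.1
    have e1 : ∫ x, ‖h x‖ ∂μ = (eLpNorm h 1 μ).toReal := by
      rw [integral_norm_eq_lintegral_enorm h1.1, eLpNorm_one_eq_lintegral_enorm]
    have e2 : ‖e.toLinearMap h‖ = (eLpNorm h 2 μ).toReal := by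
      change ‖ContinuousMap.toLp 2 μ ℂ h‖ = _
      rw [Lp.norm_def, eLpNorm_congr_ae (ContinuousMap.coeFn_toLp μ h)]
    rw [e1, e2, ← ENNReal.toReal_mul]
    apply ENNReal.toReal_mono _ (by rw [mul_comm]; exact hle)
    refine ENNReal.mul_ne_top ?_ h2.2.ne
    refine ENNReal.rpow_ne_top_of_nonneg (by norm_num) (measure_ne_top _ _)
  let U : Lp ℂ 2 μ →L[ℂ] ℂ := u.toLinearMap.extendOfNorm e.toLinearMap
  have hU : ∀ h, U (e h) = u h := fun h => LinearMap.extendOfNorm_eq hdense hnorm h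
  let w : Lp ℂ 2 μ := (InnerProductSpace.toDual ℂ _).symm U
  have hw : ∀ f, inner ℂ w f = U f := fun f => InnerProductSpace.toDual_symm_apply
  refine ⟨fun x => conj (w x), ?_, ?_, ?_⟩
  · exact (Complex.continuous_conj.measurable).comp (Lp.stronglyMeasurable w).measurable
  · have : Integrable w μ := (Lp.memLp w).integrable (by norm_num)
    exact (Complex.conjLIE.toContinuousLinearEquiv.toContinuousLinearMap).integrable_comp this
  · intro h
    rw [← hU, ← hw, L2.inner_def]
    refine integral_congr_ae ?_
    filter_upwards [ContinuousMap.coeFn_toLp (p := 2) (𝕜 := ℂ) μ h] with x hx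
    rw [RCLike.inner_apply]
    change (e h) x * _ = _
    change (ContinuousMap.toLp 2 μ ℂ h) x * _ = _
    rw [hx, mul_comm]

/-- bounded measurable functions are a.e. limits of equibounded continuous ones -/
lemma exists_cont_approx {K : Type*} [PseudoMetricSpace K] [CompactSpace K]
    [MeasurableSpace K] [BorelSpace K] (μ : Measure K) [IsFiniteMeasure μ]
    (v : K → ℂ) (hv : Measurable v) (hv1 : ∀ x, ‖v x‖ ≤ 1) :
    ∃ h : ℕ → C(K, ℂ), (∀ n, ‖h n‖ ≤ 1) ∧
      ∀ᵐ x ∂μ, Tendsto (fun n => h n x) atTop (𝓝 (v x)) := by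
  have hvL : MemLp v 1 μ := by
    refine MemLp.of_bound hv.aestronglyMeasurable 1 (Eventually.of_forall hv1)
  have hε : ∀ n : ℕ, ((n : ENNReal) + 1)⁻¹ ≠ 0 := by
    intro n; simp
  choose g hg hg' using fun n : ℕ =>
    hvL.exists_boundedContinuous_eLpNorm_sub_le (by simp) (hε n)
  have hlim : Tendsto (fun n => eLpNorm ((g n : K → ℂ) - v) 1 μ) atTop (𝓝 0) := by
    have h0 : Tendsto (fun n : ℕ => ((n : ENNReal) + 1)⁻¹) atTop (𝓝 0) := by
      have := ENNReal.tendsto_inv_nat_nhds_zero.comp (tendsto_add_atTop_nat 1)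
      simpa [Function.comp_def] using this
    refine tendsto_of_tendsto_of_tendsto_of_le_of_le tendsto_const_nhds h0 (fun _ => zero_le) ?_
    intro n
    change eLpNorm ((g n : K → ℂ) - v) 1 μ ≤ _
    rw [eLpNorm_sub_comm]; exact hg n
  obtain ⟨ns, -, hns⟩ := (tendstoInMeasure_of_tendsto_eLpNorm (by simp)
    (fun n => (hg' n).1) hvL.1 hlim).exists_seq_tendsto_ae
  let cl : ℂ → ℂ := fun z => z / ((max 1 ‖z‖ : ℝ) : ℂ)
  have hcl : Continuous cl := by
    refine continuous_id.div (by fun_prop) fun z => ?_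
    have : (0:ℝ) < max 1 ‖z‖ := by positivity
    exact_mod_cast this.ne'
  refine ⟨fun n => ⟨fun x => cl (g (ns n) x), hcl.comp (g (ns n)).continuous⟩, fun n => ?_, ?_⟩
  · refine (ContinuousMap.norm_le _ zero_le_one).2 fun x => ?_
    change ‖g (ns n) x / ((max 1 ‖g (ns n) x‖ : ℝ) : ℂ)‖ ≤ 1
    rw [norm_div, Complex.norm_real, Real.norm_of_nonneg (by positivity), div_le_one (by positivity)]
    exact le_max_right _ _
  · filter_upwards [hns] with x hx
    have h1 := (hcl.tendsto (v x)).comp hx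
    have h2 : cl (v x) = v x := by simp [cl, max_eq_left (hv1 x)]
    rw [h2] at h1
    exact h1

lemma tendsto_integral_approx {K : Type*} [PseudoMetricSpace K] [CompactSpace K]
    [MeasurableSpace K] [BorelSpace K] (μ : Measure K)
    (v : K → ℂ) (h : ℕ → C(K, ℂ)) (h1 : ∀ n, ‖h n‖ ≤ 1)
    (hlim : ∀ᵐ x ∂μ, Tendsto (fun n => h n x) atTop (𝓝 (v x)))
    (φ : K → ℂ) (hφ : Integrable φ μ) :
    Tendsto (fun n => ∫ x, φ x * h n x ∂μ) atTop (𝓝 (∫ x, φ x * v x ∂μ)) := by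
  refine tendsto_integral_of_dominated_convergence (fun x => ‖φ x‖) ?_ hφ.norm ?_ ?_
  · intro n
    exact hφ.1.mul (h n).continuous.measurable.aestronglyMeasurable
  · intro n
    refine Eventually.of_forall fun x => ?_
    rw [norm_mul]
    have := ((h n).norm_coe_le_norm x).trans (h1 n)
    nlinarith [norm_nonneg (φ x)]
  · filter_upwards [hlim] with x hx using hx.const_mul _

/-- the conjugate sign -/
noncomputable def csgn (z : ℂ) : ℂ := conj z / (‖z‖ : ℂ)

lemma csgn_norm (z : ℂ) : ‖csgn z‖ ≤ 1 := by
  unfold csgn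
  rw [norm_div]
  simp only [RCLike.norm_conj, Complex.norm_real, norm_norm]
  exact div_self_le_one _

lemma mul_csgn (z : ℂ) : z * csgn z = (‖z‖ : ℂ) := by
  unfold csgn
  by_cases hz : z = 0
  · simp [hz]
  · have : (‖z‖ : ℂ) ≠ 0 := by simpa using hz
    field_simp
    rw [Complex.mul_conj, Complex.normSq_eq_norm_sq]; push_cast; ring

lemma measurable_csgn : Measurable csgn := by
  unfold csgn
  have : Measurable (fun z : ℂ => conj z) := Complex.continuous_conj.measurable
  exact this.div (by fun_prop)

lemma integral_norm_le_of_cont {K : Type*} [PseudoMetricSpace K] [CompactSpace K]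
    [MeasurableSpace K] [BorelSpace K] (μ : Measure K) [IsFiniteMeasure μ]
    (ψ : K → ℂ) (hm : Measurable ψ) (hψ : Integrable ψ μ) (c : ℝ)
    (hc : ∀ h : C(K, ℂ), ‖h‖ ≤ 1 → ‖∫ x, ψ x * h x ∂μ‖ ≤ c) : ∫ x, ‖ψ x‖ ∂μ ≤ c := by
  obtain ⟨h, h1, hlim⟩ := exists_cont_approx μ (fun x => csgn (ψ x)) (measurable_csgn.comp hm)
    (fun x => csgn_norm _)
  have := (tendsto_integral_approx μ _ h h1 hlim ψ hψ).norm
  have h2 := le_of_tendsto this (Eventually.of_forall fun n => hc (h n) (h1 n))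
  simp_rw [mul_csgn] at h2
  rw [integral_complex_ofReal, Complex.norm_real] at h2
  exact (le_abs_self _).trans h2

lemma abs_cont_single {Ω : Type*} [MeasurableSpace Ω] (μ : Measure Ω) [IsFiniteMeasure μ]
    (φ : Ω → ℂ) (hφ : Integrable φ μ) (ε : ℝ) (hε : 0 < ε) :
    ∃ τ > 0, ∀ A, MeasurableSet A → μ.real A ≤ τ → ∫ x in A, ‖φ x‖ ∂μ ≤ ε := by
  obtain ⟨δ, hδ, h⟩ := exists_pos_setLIntegral_lt_of_measure_lt (μ := μ) (f := fun x => ‖φ x‖ₑ)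
    hφ.2.ne (ε := ENNReal.ofReal ε) (by simpa using hε)
  obtain ⟨τ, hτ, hτδ⟩ : ∃ τ : ℝ, 0 < τ ∧ ENNReal.ofReal τ < δ := by
    obtain ⟨q, hq0, hq⟩ := ENNReal.lt_iff_exists_nnreal_btwn.1 hδ
    exact ⟨q, by exact_mod_cast hq0, by simpa using hq⟩
  refine ⟨τ, hτ, fun A hA hAτ => ?_⟩
  have h1 : μ A < δ := by
    refine lt_of_le_of_lt ?_ hτδ
    rw [← ofReal_measureReal]
    exact ENNReal.ofReal_le_ofReal hAτ
  rw [integral_norm_eq_lintegral_enorm hφ.1.restrict]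
  exact ENNReal.toReal_le_of_le_ofReal hε.le (h A h1).le

lemma bessel_measurable {K : Type*} [PseudoMetricSpace K] [CompactSpace K]
    [MeasurableSpace K] [BorelSpace K] (μ : Measure K) [IsFiniteMeasure μ]
    (φ : ℕ → K → ℂ) (hφ : ∀ n, Integrable (φ n) μ) (C : ℝ)
    (hB : ∀ (N : ℕ) (h : C(K, ℂ)), ‖h‖ ≤ 1 →
      ∑ n ∈ range N, ‖∫ x, φ n x * h x ∂μ‖ ^ 2 ≤ C)
    (v : K → ℂ) (hv : Measurable v) (hv1 : ∀ x, ‖v x‖ ≤ 1) (N : ℕ) :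
    ∑ n ∈ range N, ‖∫ x, φ n x * v x ∂μ‖ ^ 2 ≤ C := by
  obtain ⟨h, h1, hlim⟩ := exists_cont_approx μ v hv hv1
  have : Tendsto (fun j => ∑ n ∈ range N, ‖∫ x, φ n x * h j x ∂μ‖ ^ 2) atTop
      (𝓝 (∑ n ∈ range N, ‖∫ x, φ n x * v x ∂μ‖ ^ 2)) :=
    tendsto_finsetSum _ fun n _ => ((tendsto_integral_approx μ _ h h1 hlim (φ n) (hφ n)).norm.pow 2)
  exact le_of_tendsto this (Eventually.of_forall fun j => hB N (h j) (h1 j))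

lemma equi_abs_cont {K : Type*} [PseudoMetricSpace K] [CompactSpace K]
    [MeasurableSpace K] [BorelSpace K] (μ : Measure K) [IsFiniteMeasure μ]
    (φ : ℕ → K → ℂ) (hm : ∀ n, Measurable (φ n)) (hφ : ∀ n, Integrable (φ n) μ) (C : ℝ)
    (hB : ∀ (N : ℕ) (h : C(K, ℂ)), ‖h‖ ≤ 1 →
      ∑ n ∈ range N, ‖∫ x, φ n x * h x ∂μ‖ ^ 2 ≤ C) (ε : ℝ) (hε : 0 < ε) :
    ∃ τ > 0, ∀ n A, MeasurableSet A → μ.real A ≤ τ → ∫ x in A, ‖φ n x‖ ∂μ ≤ ε := by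
  by_contra! hcon
  have claim : ∀ j : ℕ, ∀ η > 0, ∃ B, MeasurableSet B ∧ μ.real B ≤ η ∧ ∃ v : K → ℂ,
      Measurable v ∧ (∀ x, ‖v x‖ ≤ 1) ∧ (∀ x, x ∉ B → v x = 0) ∧ ∃ N : ℕ,
        j * (ε ^ 2 / 4) ≤ ∑ n ∈ range N, ‖∫ x, φ n x * v x ∂μ‖ ^ 2 := by
    intro j
    induction j with
    | zero =>
      intro η hη
      refine ⟨∅, MeasurableSet.empty, by simpa using hη.le, fun _ => 0, measurable_const, by simp, by simp, 0, by simp⟩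
    | succ j ih =>
      intro η hη
      obtain ⟨n₁, A, hA, hAη, hAε⟩ := hcon (η / 2) (by positivity)
      obtain ⟨τ, hτ, hτ'⟩ := abs_cont_single μ (φ n₁) (hφ n₁) (ε / 2) (by positivity)
      obtain ⟨B, hBm, hBη, v, hv, hv1, hv0, N, hN⟩ := ih (min τ (η / 2)) (by positivity)
      have hBτ := hτ' B hBm (hBη.trans (min_le_left _ _))
      have hBη := hBη.trans (min_le_right _ _)
      let w : K → ℂ := (A \ B).indicator fun x => csgn (φ n₁ x)
      have hw : Measurable w := (measurable_csgn.comp (hm n₁)).indicator (hA.diff hBm)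
      have hw1 : ∀ x, ‖w x‖ ≤ 1 := fun x =>
        (norm_indicator_le_norm_self _ _).trans (csgn_norm _)
      have hw2 : ε / 2 ≤ ‖∫ x, φ n₁ x * w x ∂μ‖ := by
        have e : (fun x => φ n₁ x * w x) = (A \ B).indicator (fun x => ((‖φ n₁ x‖ : ℝ) : ℂ)) := by
          funext x
          simp only [w, Set.indicator]
          split_ifs
          · exact mul_csgn _
          · simp
        rw [e, integral_indicator (hA.diff hBm), integral_complex_ofReal, Complex.norm_real]
        refine le_trans ?_ (le_abs_self _)
        have h1 : ∫ x in A, ‖φ n₁ x‖ ∂μ ≤ ∫ x in (A \ B) ∪ B, ‖φ n₁ x‖ ∂μ :=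
          setIntegral_mono_set (hφ n₁).norm.integrableOn
            (Eventually.of_forall fun x => norm_nonneg _)
            (Eventually.of_forall fun x hx => by
              by_cases hb : x ∈ B
              · exact Or.inr hb
              · exact Or.inl ⟨hx, hb⟩)
        rw [setIntegral_union Set.disjoint_sdiff_left hBm (hφ n₁).norm.integrableOn
          (hφ n₁).norm.integrableOn] at h1
        linarith
      -- choose the sign
      let N' := max N (n₁ + 1)
      have hi : ∀ n (z : K → ℂ), Measurable z → (∀ x, ‖z x‖ ≤ 1) →
          Integrable (fun x => φ n x * z x) μ := fun n z hz hz1 =>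
        (hφ n).mul_bdd (c := 1) hz.aestronglyMeasurable (Eventually.of_forall hz1)
      have hsv : (j : ℝ) * (ε ^ 2 / 4) ≤ ∑ n ∈ range N', ‖∫ x, φ n x * v x ∂μ‖ ^ 2 :=
        hN.trans (Finset.sum_le_sum_of_subset_of_nonneg
          (Finset.range_mono (le_max_left _ _)) fun _ _ _ => by positivity)
      have hsw : ε ^ 2 / 4 ≤ ∑ n ∈ range N', ‖∫ x, φ n x * w x ∂μ‖ ^ 2 := by
        refine le_trans ?_ (Finset.single_le_sum (f := fun n => ‖∫ x, φ n x * w x ∂μ‖ ^ 2)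
          (fun _ _ => by positivity) (Finset.mem_range.2 (lt_of_lt_of_le (Nat.lt_succ_self n₁) (le_max_right N _))))
        nlinarith
      have hpar : ∑ n ∈ range N', ‖∫ x, φ n x * (v x + w x) ∂μ‖ ^ 2
          + ∑ n ∈ range N', ‖∫ x, φ n x * (v x - w x) ∂μ‖ ^ 2
          = 2 * (∑ n ∈ range N', ‖∫ x, φ n x * v x ∂μ‖ ^ 2
            + ∑ n ∈ range N', ‖∫ x, φ n x * w x ∂μ‖ ^ 2) := by
        rw [← Finset.sum_add_distrib, ← Finset.sum_add_distrib, Finset.mul_sum]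
        refine Finset.sum_congr rfl fun n _ => ?_
        simp_rw [mul_add, mul_sub]
        rw [integral_add (hi n v hv hv1) (hi n w hw hw1),
          integral_sub (hi n v hv hv1) (hi n w hw hw1)]
        have := parallelogram_law_with_norm ℝ (∫ x, φ n x * v x ∂μ) (∫ x, φ n x * w x ∂μ)
        linarith
      have hcase : ∃ s : ℂ, ‖s‖ = 1 ∧ ((j + 1 : ℕ) : ℝ) * (ε ^ 2 / 4) ≤
          ∑ n ∈ range N', ‖∫ x, φ n x * (v x + s * w x) ∂μ‖ ^ 2 := by
        by_contra! hno
        have h1 := hno 1 (by simp)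
        have h2 := hno (-1) (by simp)
        simp only [one_mul, neg_mul, ← sub_eq_add_neg] at h1 h2
        push_cast at h1 h2
        linarith
      obtain ⟨s, hs, hs'⟩ := hcase
      refine ⟨A ∪ B, hA.union hBm, ?_, fun x => v x + s * w x, ?_, ?_, ?_, N', hs'⟩
      · exact (measureReal_union_le _ _).trans (by linarith)
      · exact hv.add (measurable_const.mul hw)
      · intro x
        by_cases hb : x ∈ B
        · have : w x = 0 := Set.indicator_of_notMem (fun h => h.2 hb) _
          simpa [this] using hv1 x
        · simpa [hv0 x hb, hs] using hw1 x
      · intro x hx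
        have hb : x ∉ B := fun h => hx (Or.inr h)
        have : w x = 0 := Set.indicator_of_notMem (fun h => hx (Or.inl h.1)) _
        simp [this, hv0 x hb]
  obtain ⟨j, hj⟩ := exists_nat_gt (C / (ε ^ 2 / 4))
  obtain ⟨B, -, -, v, hv, hv1, -, N, hN⟩ := claim j 1 one_pos
  have := bessel_measurable μ φ hφ C hB v hv hv1 N
  rw [div_lt_iff₀ (by positivity)] at hj
  linarith

/-- Abstract Olevskii-type growth argument. -/
lemma olevskii {Ω : Type*} [MeasurableSpace Ω] (ν : Measure Ω) [IsFiniteMeasure ν]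
    (F : ℕ → Ω → ℂ) (hF : ∀ n, Integrable (F n) ν)
    (hUI : ∀ ε > 0, ∃ τ > 0, ∀ n A, MeasurableSet A → ν.real A ≤ τ → ∫ x in A, ‖F n x‖ ∂ν ≤ ε)
    (C δ : ℝ) (hδ : 0 < δ)
    (hblock : ∀ s l : ℕ, 0 < l → ∃ E, MeasurableSet E ∧ ν.real E ≤ C / l ∧
      δ ≤ ∫ x in E, ‖∑ n ∈ Ico s (s + l), F n x‖ ∂ν) (m : ℕ) :
    ∃ k, m * (δ / 4) ≤ ∫ x, ‖∑ n ∈ range k, F n x‖ ∂ν := by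
  have hInteg : ∀ S : Finset ℕ, Integrable (fun x => ∑ n ∈ S, F n x) ν := fun S =>
    integrable_finsetSum _ fun n _ => hF n
  have hsum : ∀ (S : Finset ℕ) (A : Set Ω) (c : ℝ), (∀ n, ∫ x in A, ‖F n x‖ ∂ν ≤ c) →
      ∫ x in A, ‖∑ n ∈ S, F n x‖ ∂ν ≤ S.card * c := by
    intro S A c hc
    calc ∫ x in A, ‖∑ n ∈ S, F n x‖ ∂ν ≤ ∫ x in A, ∑ n ∈ S, ‖F n x‖ ∂ν :=
          integral_mono (hInteg S).norm.integrableOn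
            (integrable_finsetSum _ fun n _ => (hF n).norm.integrableOn) fun x => norm_sum_le _ _
      _ = ∑ n ∈ S, ∫ x in A, ‖F n x‖ ∂ν :=
          integral_finsetSum _ fun n _ => (hF n).norm.integrableOn
      _ ≤ ∑ n ∈ S, c := Finset.sum_le_sum fun n _ => hc n
      _ = _ := by simp
  have key : ∀ m : ℕ, ∃ Λ : ℕ, ∃ τ > 0, ∀ s A, MeasurableSet A → ν.real A ≤ τ →
      ∃ k, s ≤ k ∧ k ≤ s + Λ ∧ m * (δ / 4) ≤ ∫ x in Aᶜ, ‖∑ n ∈ range k, F n x‖ ∂ν := by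
    intro m
    induction m with
    | zero =>
      refine ⟨0, 1, one_pos, fun s A _ _ => ⟨s, le_rfl, le_rfl, ?_⟩⟩
      simpa using integral_nonneg fun x => norm_nonneg _
    | succ m ih =>
      obtain ⟨Λ, τ, hτ, H⟩ := ih
      obtain ⟨τ1, hτ1, hU1⟩ := hUI (δ / 8 / (Λ + 1)) (by positivity)
      obtain ⟨l, hl⟩ := exists_nat_gt (max 0 (C / min (τ / 2) τ1))
      have hl0 : 0 < l := by exact_mod_cast lt_of_le_of_lt (le_max_left _ _) hl
      have hlR : (0:ℝ) < l := by exact_mod_cast hl0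
      have hCl : C / l ≤ min (τ / 2) τ1 := by
        have := lt_of_le_of_lt (le_max_right _ _) hl
        rw [div_lt_iff₀ (by positivity)] at this
        rw [div_le_iff₀ hlR]; linarith
      obtain ⟨τ2, hτ2, hU2⟩ := hUI (δ / 4 / l) (by positivity)
      refine ⟨l + Λ, min (τ / 2) τ2, by positivity, fun s A hA hAτ => ?_⟩
      obtain ⟨E, hE, hEm, hEδ⟩ := hblock s l hl0
      have hEm := hEm.trans hCl
      have hA2 : ∫ x in A, ‖∑ n ∈ Ico s (s + l), F n x‖ ∂ν ≤ δ / 4 := by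
        have := hsum (Ico s (s + l)) A _ fun n => hU2 n A hA (hAτ.trans (min_le_right _ _))
        simp only [Nat.card_Ico, add_tsub_cancel_left] at this
        rw [mul_div_cancel₀ _ hlR.ne'] at this
        exact this
      have hEA : 3 * δ / 4 ≤ ∫ x in E \ A, ‖∑ n ∈ Ico s (s + l), F n x‖ ∂ν := by
        have h1 : ∫ x in E, ‖∑ n ∈ Ico s (s + l), F n x‖ ∂ν
            ≤ ∫ x in (E \ A) ∪ A, ‖∑ n ∈ Ico s (s + l), F n x‖ ∂ν :=
          setIntegral_mono_set (hInteg _).norm.integrableOn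
            (Eventually.of_forall fun x => norm_nonneg _)
            (Eventually.of_forall fun x hx => by
              by_cases hb : x ∈ A
              · exact Or.inr hb
              · exact Or.inl ⟨hx, hb⟩)
        rw [setIntegral_union Set.disjoint_sdiff_left hA (hInteg _).norm.integrableOn
          (hInteg _).norm.integrableOn] at h1
        linarith
      have hsplit : ∫ x in E \ A, ‖∑ n ∈ Ico s (s + l), F n x‖ ∂ν ≤
          ∫ x in E \ A, ‖∑ n ∈ range (s + l), F n x‖ ∂ν + ∫ x in E \ A, ‖∑ n ∈ range s, F n x‖ ∂ν := by
        rw [← integral_add (hInteg _).norm.integrableOn (hInteg _).norm.integrableOn]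
        refine integral_mono (hInteg _).norm.integrableOn
          ((hInteg _).norm.integrableOn.add (hInteg _).norm.integrableOn) fun x => ?_
        change ‖∑ n ∈ Ico s (s + l), F n x‖ ≤ ‖∑ n ∈ range (s + l), F n x‖ + ‖∑ n ∈ range s, F n x‖
        rw [Finset.sum_Ico_eq_sub _ (Nat.le_add_right s l)]
        exact norm_sub_le _ _
      obtain ⟨s', hs1, hs2, hs3⟩ : ∃ s', s ≤ s' ∧ s' ≤ s + l ∧
          3 * δ / 8 ≤ ∫ x in E \ A, ‖∑ n ∈ range s', F n x‖ ∂ν := by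
        by_contra! hno
        have h1 := hno s le_rfl (Nat.le_add_right _ _)
        have h2 := hno (s + l) (Nat.le_add_right _ _) le_rfl
        linarith
      obtain ⟨k, hk1, hk2, hk3⟩ := H s' (A ∪ E) (hA.union hE) (by
        have h1 := measureReal_union_le (μ := ν) A E
        have h2 := hAτ.trans (min_le_left _ _)
        have h3 := hEm.trans (min_le_left _ _)
        linarith)
      refine ⟨k, hs1.trans hk1, by omega, ?_⟩
      have hEk : ∫ x in E \ A, ‖∑ n ∈ Ico s' k, F n x‖ ∂ν ≤ δ / 8 := by
        have hEA' : ν.real (E \ A) ≤ τ1 :=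
          (measureReal_mono Set.sdiff_subset).trans (hEm.trans (min_le_right _ _))
        have := hsum (Ico s' k) (E \ A) _ fun n => hU1 n _ (hE.diff hA) hEA'
        refine this.trans ?_
        have hc : ((Ico s' k).card : ℝ) ≤ Λ + 1 := by
          rw [Nat.card_Ico]
          have : k - s' ≤ Λ + 1 := by omega
          exact_mod_cast this
        calc ((Ico s' k).card : ℝ) * (δ / 8 / (Λ + 1)) ≤ (Λ + 1) * (δ / 8 / (Λ + 1)) := by gcongr
          _ = δ / 8 := by field_simp
      have hsplit2 : ∫ x in E \ A, ‖∑ n ∈ range s', F n x‖ ∂ν ≤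
          ∫ x in E \ A, ‖∑ n ∈ range k, F n x‖ ∂ν + ∫ x in E \ A, ‖∑ n ∈ Ico s' k, F n x‖ ∂ν := by
        rw [← integral_add (hInteg _).norm.integrableOn (hInteg _).norm.integrableOn]
        refine integral_mono (hInteg _).norm.integrableOn
          ((hInteg _).norm.integrableOn.add (hInteg _).norm.integrableOn) fun x => ?_
        change ‖∑ n ∈ range s', F n x‖ ≤ ‖∑ n ∈ range k, F n x‖ + ‖∑ n ∈ Ico s' k, F n x‖
        rw [Finset.sum_Ico_eq_sub _ hk1]
        have := norm_sub_le (∑ n ∈ range k, F n x) (∑ n ∈ range k, F n x - ∑ n ∈ range s', F n x)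
        simpa using this
      have hdec : Aᶜ = (A ∪ E)ᶜ ∪ (E \ A) := by
        ext x; simp only [Set.mem_compl_iff, Set.mem_union, Set.mem_sdiff]; tauto
      rw [hdec, setIntegral_union _ (hE.diff hA) (hInteg _).norm.integrableOn
        (hInteg _).norm.integrableOn]
      · push_cast
        linarith
      · rw [Set.disjoint_left]
        rintro x hx ⟨hx1, hx2⟩
        exact hx (Or.inr hx1)
  obtain ⟨Λ, τ, hτ, H⟩ := key m
  obtain ⟨k, -, -, hk⟩ := H 0 ∅ MeasurableSet.empty (by simpa using hτ.le)
  exact ⟨k, by simpa using hk⟩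

/-- The tail of a function above height `M`. -/
noncomputable def tailFn {K : Type*} (M : ℝ) (f : K → ℂ) : K → ℂ := {x | M < ‖f x‖}.indicator f

lemma norm_le_tail {K : Type*} (M : ℝ) (hM : 0 ≤ M) (f : K → ℂ) (x : K) :
    ‖f x‖ ≤ M + ‖tailFn M f x‖ := by
  unfold tailFn
  by_cases h : M < ‖f x‖
  · rw [Set.indicator_of_mem (show x ∈ {x | M < ‖f x‖} from h)]; linarith
  · rw [Set.indicator_of_notMem (show x ∉ {x | M < ‖f x‖} from h)]; simp; linarith

lemma tail_integrable {K : Type*} [MeasurableSpace K] (μ : Measure K) (M : ℝ) (f : K → ℂ)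
    (hm : Measurable f) (hf : Integrable f μ) : Integrable (tailFn M f) μ :=
  hf.indicator (measurableSet_lt measurable_const hm.norm)

lemma exists_tail {K : Type*} [MeasurableSpace K] (μ : Measure K) [IsFiniteMeasure μ]
    (φ : ℕ → K → ℂ) (hm : ∀ n, Measurable (φ n)) (hφ : ∀ n, Integrable (φ n) μ) (C : ℝ)
    (hC : ∀ n, ∫ x, ‖φ n x‖ ∂μ ≤ C)
    (hUI : ∀ ε > 0, ∃ τ > 0, ∀ n A, MeasurableSet A → μ.real A ≤ τ → ∫ x in A, ‖φ n x‖ ∂μ ≤ ε)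
    (κ : ℝ) (hκ : 0 < κ) : ∃ M > 0, ∀ n, ∫ x, ‖tailFn M (φ n) x‖ ∂μ ≤ κ := by
  obtain ⟨τ, hτ, H⟩ := hUI κ hκ
  have hC0 : 0 ≤ C := (integral_nonneg fun x => norm_nonneg (φ 0 x)).trans (hC 0)
  refine ⟨(C + 1) / τ, by positivity, fun n => ?_⟩
  have hms : MeasurableSet {x | (C + 1) / τ < ‖φ n x‖} := measurableSet_lt measurable_const (hm n).norm
  have e : (fun x => ‖tailFn ((C + 1) / τ) (φ n) x‖)
      = {x | (C + 1) / τ < ‖φ n x‖}.indicator (fun x => ‖φ n x‖) := by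
    funext x; unfold tailFn; rw [norm_indicator_eq_indicator_norm]
  rw [e, integral_indicator hms]
  refine H n _ hms ?_
  have h1 := mul_meas_ge_le_integral_of_nonneg (μ := μ) (f := fun x => ‖φ n x‖)
    (Eventually.of_forall fun x => norm_nonneg _) (hφ n).norm ((C + 1) / τ)
  have h2 : μ.real {x | (C + 1) / τ < ‖φ n x‖} ≤ μ.real {x | (C + 1) / τ ≤ ‖φ n x‖} :=
    measureReal_mono (by intro x hx; simp only [Set.mem_ofPred_eq] at hx ⊢; exact hx.le)
  have h3 : (C + 1) / τ * μ.real {x | (C + 1) / τ ≤ ‖φ n x‖} ≤ C + 1 := by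
    linarith [hC n]
  have h4 : μ.real {x | (C + 1) / τ ≤ ‖φ n x‖} ≤ τ := by
    rw [div_mul_eq_mul_div, div_le_iff₀ hτ] at h3
    exact le_of_mul_le_mul_left h3 (by positivity)
  exact h2.trans h4

lemma block_lower {K : Type*} [MetricSpace K] [CompactSpace K]
    [MeasurableSpace K] [BorelSpace K] (μ : Measure K) [IsFiniteMeasure μ]
    (φ : ℕ → K → ℂ) (hm : ∀ n, Measurable (φ n)) (hφ : ∀ n, Integrable (φ n) μ)
    (G : ℕ → C(K, ℂ)) (B : ℝ) (hB : 0 < B) (hG : ∀ n, ‖G n‖ ≤ B)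
    (hbi : ∀ n m, ∫ x, φ n x * G m x ∂μ = if n = m then 1 else 0)
    (L : ℝ) (hL : 0 < L)
    (hL1 : ∀ s l y, ∫ x, ‖∑ n ∈ Ico s (s + l), φ n x * G n y‖ ∂μ ≤ L)
    (M : ℝ) (hM : 0 < M) (hMt : ∀ n, ∫ x, ‖tailFn M (φ n) x‖ ∂μ ≤ 1 / (4 * B * L))
    (s l : ℕ) (hl : 0 < l) :
    ∃ E : Set (K × K), MeasurableSet E ∧
      (μ.prod μ).real E ≤ 4 * L ^ 2 * (μ.real Set.univ + 1) ^ 2 / l ∧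
      1 / (2 * M * B) ≤ ∫ p in E, ‖∑ n ∈ Ico s (s + l), φ n p.1 * G n p.2‖ ∂(μ.prod μ) := by
  set ν := μ.prod μ with hν
  set I := Ico s (s + l) with hI
  have hcard : (I.card : ℝ) = l := by simp [hI]
  have hlR : (0:ℝ) < l := by exact_mod_cast hl
  set m := μ.real Set.univ with hmdef
  have hm0 : 0 ≤ m := measureReal_nonneg
  set P : K × K → ℂ := fun p => ∑ n ∈ I, φ n p.1 * G n p.2 with hP
  set ε := 1 / (4 * L * (m + 1)) with hε
  have hε0 : 0 < ε := by positivity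
  have hGi : ∀ n, Integrable (G n) μ := fun n => (G n).memLp (p := 1) (μ := μ) ℂ |>.integrable le_rfl
  have hGB : ∀ n x, ‖G n x‖ ≤ B := fun n x => ((G n).norm_coe_le_norm x).trans (hG n)
  have hGφ : ∀ n k, Integrable (fun x => φ n x * G k x) μ := fun n k =>
    (hφ n).mul_bdd (c := B) (G k).continuous.measurable.aestronglyMeasurable
      (Eventually.of_forall (hGB k))
  have hPm : Measurable P := by
    refine Finset.measurable_sum _ fun n _ => ?_
    exact ((hm n).comp measurable_fst).mul ((G n).continuous.measurable.comp measurable_snd)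
  have hPi : Integrable P ν := integrable_finsetSum _ fun n _ => (hφ n).mul_prod (hGi n)
  have hPi' : Integrable (fun p => P p.swap) ν := hPi.swap
  have hPL : ∫ p, ‖P p‖ ∂ν ≤ L * m := by
    rw [integral_prod_symm _ hPi.norm]
    calc ∫ y, ∫ x, ‖P (x, y)‖ ∂μ ∂μ ≤ ∫ y, L ∂μ :=
          integral_mono hPi.norm.swap.integral_prod_left (integrable_const _) fun y => hL1 s l y
      _ = L * m := by simp [hmdef, mul_comm]
  have hPL' : ∫ p, ‖P p.swap‖ ∂ν ≤ L * m := by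
    have := integral_prod_swap (μ := μ) (ν := μ) (fun p => ‖P p‖)
    rw [hν, this]; exact hPL
  let E : Set (K × K) := {p | ε * l < ‖P p‖}
  have hE : MeasurableSet E := measurableSet_lt measurable_const hPm.norm
  refine ⟨E, hE, ?_, ?_⟩
  · have h1 := mul_meas_ge_le_integral_of_nonneg (μ := ν) (f := fun p => ‖P p‖)
      (Eventually.of_forall fun x => norm_nonneg _) hPi.norm (ε * l)
    have h2 : ν.real E ≤ ν.real {p | ε * l ≤ ‖P p‖} :=
      measureReal_mono (by intro p hp; change ε * l < ‖P p‖ at hp; exact hp.le)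
    have h3 : ε * l * ν.real E ≤ L * (m + 1) := by
      have : ε * l * ν.real E ≤ ε * l * ν.real {p | ε * l ≤ ‖P p‖} := by gcongr
      nlinarith
    rw [le_div_iff₀ hlR]
    rw [hε, div_mul_eq_mul_div, div_mul_eq_mul_div, div_le_iff₀ (by positivity)] at h3
    nlinarith
  · -- the trace identity
    have htr : ∫ p, P p * P p.swap ∂ν = l := by
      have e1 : (fun p : K × K => P p * P p.swap) = fun p => ∑ n ∈ I, ∑ k ∈ I,
          (φ n p.1 * G k p.1) * (φ k p.2 * G n p.2) := by
        funext p
        simp only [hP, Finset.sum_mul_sum, Prod.fst_swap, Prod.snd_swap]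
        refine Finset.sum_congr rfl fun n _ => Finset.sum_congr rfl fun k _ => by ring
      rw [e1, integral_finsetSum _ fun n _ => integrable_finsetSum _ fun k _ =>
        (hGφ n k).mul_prod (hGφ k n)]
      have e2 : ∀ n ∈ I, ∫ p, ∑ k ∈ I, (φ n p.1 * G k p.1) * (φ k p.2 * G n p.2) ∂ν = 1 := by
        intro n hn
        rw [integral_finsetSum _ fun k _ => (hGφ n k).mul_prod (hGφ k n)]
        have e3 : ∀ k ∈ I, ∫ p, (φ n p.1 * G k p.1) * (φ k p.2 * G n p.2) ∂ν
            = if n = k then 1 else 0 := by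
          intro k _
          rw [hν, integral_prod_mul (fun x => φ n x * G k x) (fun y => φ k y * G n y), hbi, hbi]
          by_cases h : n = k
          · simp [h]
          · simp [h, Ne.symm h]
        rw [Finset.sum_congr rfl e3]
        simp [hn]
      rw [Finset.sum_congr rfl e2]
      simp [hI]
    have htr' : (l : ℝ) ≤ ∫ p, ‖P p‖ * ‖P p.swap‖ ∂ν := by
      have := norm_integral_le_integral_norm (μ := ν) (fun p => P p * P p.swap)
      rw [htr] at this
      simpa [norm_mul] using this
    let r : ℕ → K → ℂ := fun n => tailFn M (φ n)
    have hr : ∀ n, Integrable (r n) μ := fun n => tail_integrable μ M _ (hm n) (hφ n)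
    have hPr : ∀ k, Integrable (fun p : K × K => P p * r k p.2) ν := by
      intro k
      have e : (fun p : K × K => P p * r k p.2)
          = fun p => ∑ n ∈ I, φ n p.1 * (r k p.2 * G n p.2) := by
        funext p
        simp only [hP, Finset.sum_mul]
        refine Finset.sum_congr rfl fun n _ => by ring
      rw [e]
      refine integrable_finsetSum _ fun n _ => ?_
      have h1 : Integrable (fun y => r k y * G n y) μ :=
        (hr k).mul_bdd (c := B) (G n).continuous.measurable.aestronglyMeasurable
          (Eventually.of_forall (hGB n))
      exact Integrable.mul_prod (hφ n) h1
    have hPr' : ∀ k, ∫ p, ‖P p * r k p.2‖ ∂ν ≤ 1 / (4 * B) := by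
      intro k
      rw [integral_prod_symm _ (hPr k).norm]
      calc ∫ y, ∫ x, ‖P (x, y) * r k y‖ ∂μ ∂μ ≤ ∫ y, L * ‖r k y‖ ∂μ := by
            refine integral_mono (hPr k).norm.swap.integral_prod_left ((hr k).norm.const_mul L)
              fun y => ?_
            change ∫ x, ‖P (x, y) * r k y‖ ∂μ ≤ L * ‖r k y‖
            simp_rw [norm_mul]
            rw [integral_mul_const]
            exact mul_le_mul_of_nonneg_right (hL1 s l y) (norm_nonneg _)
        _ = L * ∫ y, ‖r k y‖ ∂μ := integral_const_mul _ _
        _ ≤ L * (1 / (4 * B * L)) := by gcongr; exact hMt k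
        _ = 1 / (4 * B) := by field_simp
    have hpt : ∀ p, ‖P p‖ * ‖P p.swap‖ ≤ ε * l * ‖P p.swap‖
        + M * B * l * E.indicator (fun p => ‖P p‖) p + B * ∑ k ∈ I, ‖P p * r k p.2‖ := by
      intro p
      have hs0 : 0 ≤ B * ∑ k ∈ I, ‖P p * r k p.2‖ := by positivity
      by_cases hp : p ∈ E
      · rw [Set.indicator_of_mem hp]
        have h1 : ‖P p.swap‖ ≤ ∑ k ∈ I, B * (M + ‖r k p.2‖) := by
          refine (norm_sum_le _ _).trans (Finset.sum_le_sum fun k _ => ?_)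
          rw [norm_mul, mul_comm]
          exact mul_le_mul (hGB _ _) (norm_le_tail M hM.le _ _) (norm_nonneg _) hB.le
        have h2 : ∑ k ∈ I, B * (M + ‖r k p.2‖) = M * B * l + B * ∑ k ∈ I, ‖r k p.2‖ := by
          rw [← Finset.mul_sum, Finset.sum_add_distrib, Finset.sum_const, nsmul_eq_mul, hcard]; ring
        have h3 : B * ∑ k ∈ I, ‖P p * r k p.2‖ = ‖P p‖ * (B * ∑ k ∈ I, ‖r k p.2‖) := by
          simp_rw [norm_mul]; rw [← Finset.mul_sum]; ring
        rw [h3]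
        have h4 := mul_le_mul_of_nonneg_left (h1.trans h2.le) (norm_nonneg (P p))
        have h5 : 0 ≤ ε * l * ‖P p.swap‖ := by positivity
        linarith
      · rw [Set.indicator_of_notMem hp]
        have hp' : ‖P p‖ ≤ ε * l := not_lt.1 hp
        have := mul_le_mul_of_nonneg_right hp' (norm_nonneg (P p.swap))
        linarith
    have i1 : Integrable (fun p : K × K => ε * l * ‖P p.swap‖) ν := hPi'.norm.const_mul _
    have i2 : Integrable (fun p : K × K => M * B * l * E.indicator (fun p => ‖P p‖) p) ν :=
      (hPi.norm.indicator hE).const_mul _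
    have i3 : Integrable (fun p : K × K => B * ∑ k ∈ I, ‖P p * r k p.2‖) ν :=
      (integrable_finsetSum _ fun k _ => (hPr k).norm).const_mul _
    have i12 : Integrable (fun p : K × K => ε * l * ‖P p.swap‖
        + M * B * l * E.indicator (fun p => ‖P p‖) p) ν := i1.add i2
    have hfin : (l : ℝ) ≤ ε * l * (L * m) + M * B * l * (∫ p in E, ‖P p‖ ∂ν)
        + B * (l * (1 / (4 * B))) := by
      calc (l : ℝ) ≤ ∫ p, ‖P p‖ * ‖P p.swap‖ ∂ν := htr'
        _ ≤ ∫ p, (ε * l * ‖P p.swap‖ + M * B * l * E.indicator (fun p => ‖P p‖) p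
            + B * ∑ k ∈ I, ‖P p * r k p.2‖) ∂ν :=
          integral_mono_of_nonneg (Eventually.of_forall fun p => by positivity)
            ((i1.add i2).add i3) (Eventually.of_forall hpt)
        _ = ε * l * ∫ p, ‖P p.swap‖ ∂ν + M * B * l * (∫ p in E, ‖P p‖ ∂ν)
            + B * ∑ k ∈ I, ∫ p, ‖P p * r k p.2‖ ∂ν := by
          rw [integral_add i12 i3, integral_add i1 i2, integral_const_mul,
            integral_const_mul, integral_const_mul, integral_indicator hE,
            integral_finsetSum _ fun k _ => (hPr k).norm]
        _ ≤ _ := by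
          gcongr
          calc ∑ k ∈ I, ∫ p, ‖P p * r k p.2‖ ∂ν ≤ ∑ k ∈ I, 1 / (4 * B) :=
                Finset.sum_le_sum fun k _ => hPr' k
            _ = _ := by rw [Finset.sum_const, nsmul_eq_mul, hcard]
    have hε1 : ε * (L * m) ≤ 1 / 4 := by
      rw [hε, div_mul_eq_mul_div, div_le_iff₀ (by positivity)]
      nlinarith
    have hB1 : B * (l * (1 / (4 * B))) = l / 4 := by field_simp
    rw [hB1] at hfin
    have h6 : (l : ℝ) * (1 / 2) ≤ l * (M * B * ∫ p in E, ‖P p‖ ∂ν) := by nlinarith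
    have h7 := le_of_mul_le_mul_left h6 hlR
    rw [div_le_iff₀ (by positivity)]
    nlinarith

lemma prod_UI {K : Type*} [MetricSpace K] [CompactSpace K]
    [MeasurableSpace K] [BorelSpace K] (μ : Measure K) [IsFiniteMeasure μ]
    (φ : ℕ → K → ℂ) (hm : ∀ n, Measurable (φ n)) (hφ : ∀ n, Integrable (φ n) μ)
    (G : ℕ → C(K, ℂ)) (B : ℝ) (hB : 0 < B) (hG : ∀ n, ‖G n‖ ≤ B)
    (htail : ∀ κ > 0, ∃ M > 0, ∀ n, ∫ x, ‖tailFn M (φ n) x‖ ∂μ ≤ κ) (ε : ℝ) (hε : 0 < ε) :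
    ∃ τ > 0, ∀ n A, MeasurableSet A → (μ.prod μ).real A ≤ τ →
      ∫ p in A, ‖φ n p.1 * G n p.2‖ ∂(μ.prod μ) ≤ ε := by
  set m := μ.real Set.univ with hmdef
  have hm0 : 0 ≤ m := measureReal_nonneg
  obtain ⟨M, hM, hMt⟩ := htail (ε / (2 * B * (m + 1))) (by positivity)
  refine ⟨ε / (2 * B * M), by positivity, fun n A hA hAτ => ?_⟩
  have hr : Integrable (tailFn M (φ n)) μ := tail_integrable μ M _ (hm n) (hφ n)
  have hr' : Integrable (fun p : K × K => ‖tailFn M (φ n) p.1‖) (μ.prod μ) := hr.norm.comp_fst μ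
  have hGB : ∀ n x, ‖G n x‖ ≤ B := fun n x => ((G n).norm_coe_le_norm x).trans (hG n)
  have hi : IntegrableOn (fun p : K × K => B * M + B * ‖tailFn M (φ n) p.1‖) A (μ.prod μ) :=
    ((integrable_const _).add (hr'.const_mul B)).integrableOn
  calc ∫ p in A, ‖φ n p.1 * G n p.2‖ ∂(μ.prod μ)
      ≤ ∫ p in A, (B * M + B * ‖tailFn M (φ n) p.1‖) ∂(μ.prod μ) := by
        refine integral_mono_of_nonneg (Eventually.of_forall fun p => norm_nonneg _) hi
          (Eventually.of_forall fun p => ?_)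
        change ‖φ n p.1 * G n p.2‖ ≤ B * M + B * ‖tailFn M (φ n) p.1‖
        rw [norm_mul, mul_comm ‖φ n p.1‖, ← mul_add]
        exact mul_le_mul (hGB _ _) (norm_le_tail M hM.le _ _) (norm_nonneg _) hB.le
    _ = (μ.prod μ).real A * (B * M) + B * ∫ p in A, ‖tailFn M (φ n) p.1‖ ∂(μ.prod μ) := by
        rw [integral_add (integrable_const _) (hr'.const_mul B).integrableOn]
        congr 1
        · simp
        · exact integral_const_mul _ _
    _ ≤ ε / (2 * B * M) * (B * M) + B * ∫ p, ‖tailFn M (φ n) p.1‖ ∂(μ.prod μ) := by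
        gcongr
        · exact Eventually.of_forall fun p => norm_nonneg _
        · exact Measure.restrict_le_self
    _ = ε / 2 + B * (m * ∫ x, ‖tailFn M (φ n) x‖ ∂μ) := by
        rw [integral_fun_fst (fun x => ‖tailFn M (φ n) x‖)]
        simp only [smul_eq_mul]
        congr 1
        field_simp
    _ ≤ ε / 2 + B * ((m + 1) * (ε / (2 * B * (m + 1)))) := by
        gcongr
        · linarith
        · exact hMt n
    _ = ε := by field_simp; norm_num

theorem no_basis {K : Type*} [MetricSpace K] [CompactSpace K]
    [MeasurableSpace K] [BorelSpace K] (G : ℕ → C(K, ℂ)) (B : ℝ) (hG : ∀ n, ‖G n‖ ≤ B)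
    (u : ℕ → C(K, ℂ) →L[ℂ] ℂ) (hu : ∀ n m : ℕ, u n (G m) = if n = m then 1 else 0)
    (C : ℝ) (hC : 0 ≤ C) (hbes : ∀ N h, ∑ n ∈ range N, ‖u n h‖ ^ 2 ≤ (C * ‖h‖) ^ 2)
    (L : ℝ) (hL : ∀ N h, ‖∑ n ∈ range N, u n h • G n‖ ≤ L * ‖h‖) : False := by
  have hu1 : ∀ n h, ‖u n h‖ ≤ C * ‖h‖ := by
    intro n h
    have h1 := Finset.single_le_sum (f := fun n => ‖u n h‖ ^ 2) (fun _ _ => by positivity)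
      (Finset.mem_range.2 (Nat.lt_succ_self n))
    exact le_of_sq_le_sq (h1.trans (hbes _ h)) (by positivity)
  obtain ⟨μ, hμ, hdom⟩ := exists_dominating_seq u C fun n => (u n).opNorm_le_bound hC (hu1 n)
  choose φ hm hφ hrep using fun n => exists_density μ (u n) (2 ^ n) (by positivity) (hdom n)
  have hφ1 : ∀ n, ∫ x, ‖φ n x‖ ∂μ ≤ C := fun n =>
    integral_norm_le_of_cont μ (φ n) (hm n) (hφ n) C fun h hh => by
      rw [← hrep]; exact (hu1 n h).trans (by nlinarith)
  have hB' : ∀ (N : ℕ) (h : C(K, ℂ)), ‖h‖ ≤ 1 →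
      ∑ n ∈ range N, ‖∫ x, φ n x * h x ∂μ‖ ^ 2 ≤ C ^ 2 := by
    intro N h hh
    simp_rw [← hrep]
    refine (hbes N h).trans ?_
    have : C * ‖h‖ ≤ C := by nlinarith
    gcongr
  have hUI := equi_abs_cont μ φ hm hφ (C ^ 2) hB'
  have htail := exists_tail μ φ hm hφ C hφ1 hUI
  set L' := |L| + 1 with hL'
  have hL'0 : 0 < L' := by positivity
  have hD : ∀ k y, ∫ x, ‖∑ n ∈ range k, φ n x * G n y‖ ∂μ ≤ L' := by
    intro k y
    have hi : ∀ n, Integrable (fun x => φ n x * G n y) μ := fun n => (hφ n).mul_const _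
    refine integral_norm_le_of_cont μ _ ?_ (integrable_finsetSum _ fun n _ => hi n) L' ?_
    · exact Finset.measurable_sum _ fun n _ => (hm n).mul_const _
    · intro h hh
      have e : ∫ x, (∑ n ∈ range k, φ n x * G n y) * h x ∂μ
          = (∑ n ∈ range k, u n h • G n) y := by
        rw [ContinuousMap.sum_apply]
        simp_rw [Finset.sum_mul]
        rw [integral_finsetSum]
        · refine Finset.sum_congr rfl fun n _ => ?_
          rw [ContinuousMap.smul_apply, smul_eq_mul, hrep, ← integral_mul_const]
          refine integral_congr_ae (Eventually.of_forall fun x => ?_)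
          change φ n x * G n y * h x = φ n x * h x * G n y
          ring
        · intro n _
          exact (hi n).mul_bdd (c := ‖h‖) h.continuous.measurable.aestronglyMeasurable
            (Eventually.of_forall h.norm_coe_le_norm)
      rw [e]
      refine (ContinuousMap.norm_coe_le_norm _ y).trans ((hL k h).trans ?_)
      have := le_abs_self L
      have := abs_nonneg L
      nlinarith [norm_nonneg h]
  have hL1 : ∀ s l y, ∫ x, ‖∑ n ∈ Ico s (s + l), φ n x * G n y‖ ∂μ ≤ 2 * L' := by
    intro s l y
    have hi : ∀ k, Integrable (fun x => ∑ n ∈ range k, φ n x * G n y) μ := fun k =>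
      integrable_finsetSum _ fun n _ => (hφ n).mul_const _
    calc ∫ x, ‖∑ n ∈ Ico s (s + l), φ n x * G n y‖ ∂μ
        ≤ ∫ x, (‖∑ n ∈ range (s + l), φ n x * G n y‖ + ‖∑ n ∈ range s, φ n x * G n y‖) ∂μ := by
          refine integral_mono_of_nonneg (Eventually.of_forall fun p => norm_nonneg _)
            ((hi _).norm.add (hi _).norm) (Eventually.of_forall fun x => ?_)
          change ‖∑ n ∈ Ico s (s + l), φ n x * G n y‖ ≤ _
          rw [Finset.sum_Ico_eq_sub _ (Nat.le_add_right s l)]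
          exact norm_sub_le _ _
      _ = _ := integral_add (hi _).norm (hi _).norm
      _ ≤ _ := by linarith [hD (s + l) y, hD s y]
  set B' := |B| + 1 with hBdef
  have hB'0 : 0 < B' := by positivity
  have hG' : ∀ n, ‖G n‖ ≤ B' := fun n => (hG n).trans ((le_abs_self B).trans (by linarith))
  obtain ⟨M, hM, hMt⟩ := htail (1 / (4 * B' * (2 * L'))) (by positivity)
  have hbi : ∀ n m, ∫ x, φ n x * G m x ∂μ = if n = m then 1 else 0 := fun n m => by
    rw [← hrep, hu]
  have hGi : ∀ n, Integrable (G n) μ := fun n => (G n).memLp (p := 1) (μ := μ) ℂ |>.integrable le_rfl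
  have hFi : ∀ n, Integrable (fun p : K × K => φ n p.1 * G n p.2) (μ.prod μ) := fun n =>
    (hφ n).mul_prod (hGi n)
  set δ := 1 / (2 * M * B') with hδ
  have hδ0 : 0 < δ := by positivity
  obtain ⟨k0, hk0⟩ := exists_nat_gt ((L' * (μ.real Set.univ)) / (δ / 4))
  obtain ⟨k, hk⟩ := olevskii (μ.prod μ) (fun n p => φ n p.1 * G n p.2) hFi
    (prod_UI μ φ hm hφ G B' hB'0 hG' htail) (4 * (2 * L') ^ 2 * (μ.real Set.univ + 1) ^ 2) δ hδ0
    (fun s l hl => block_lower μ φ hm hφ G B' hB'0 hG' hbi (2 * L') (by positivity) hL1 M hM hMt s l hl)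
    k0
  have hInteg : Integrable (fun p : K × K => ∑ n ∈ range k, φ n p.1 * G n p.2) (μ.prod μ) :=
    integrable_finsetSum _ fun n _ => hFi n
  have hup : ∫ p : K × K, ‖∑ n ∈ range k, φ n p.1 * G n p.2‖ ∂(μ.prod μ)
      ≤ L' * (μ.real Set.univ) := by
    rw [integral_prod_symm _ hInteg.norm]
    calc _ ≤ ∫ y, L' ∂μ :=
          integral_mono hInteg.norm.swap.integral_prod_left (integrable_const _) fun y => hD k y
      _ = _ := by simp [mul_comm]
  rw [div_lt_iff₀ (by positivity)] at hk0
  linarith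

lemma bessel_of_lower {E : Type*} [NormedAddCommGroup E] [NormedSpace ℂ E] (G : ℕ → E)
    (hGclosed : ∀ h : E, ∀ ε : ℝ, 0 < ε →
      ∃ (N : ℕ) (a : ℕ → ℂ), ‖h - ∑ n ∈ Finset.range N, a n • G n‖ < ε)
    (C : ℝ) (hC : 0 < C)
    (hlow : ∀ (s : Finset ℕ) (a : ℕ → ℂ),
      C⁻¹ * Real.sqrt (∑ n ∈ s, ‖a n‖ ^ 2) ≤ ‖∑ n ∈ s, a n • G n‖)
    (u : ℕ → E →L[ℂ] ℂ) (hu : ∀ n m : ℕ, u n (G m) = if n = m then 1 else 0) (N : ℕ) (h : E) :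
    ∑ n ∈ range N, ‖u n h‖ ^ 2 ≤ (C * ‖h‖) ^ 2 := by
  have hcl : IsClosed {h : E | ∑ n ∈ range N, ‖u n h‖ ^ 2 ≤ (C * ‖h‖) ^ 2} :=
    isClosed_le (by fun_prop) (by fun_prop)
  suffices h' : h ∈ closure {h : E | ∑ n ∈ range N, ‖u n h‖ ^ 2 ≤ (C * ‖h‖) ^ 2} by
    rw [hcl.closure_eq] at h'; exact h'
  rw [Metric.mem_closure_iff]
  intro ε hε
  obtain ⟨N', a, ha⟩ := hGclosed h ε hε
  refine ⟨_, ?_, by rw [dist_eq_norm]; exact ha⟩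
  change ∑ n ∈ range N, ‖u n (∑ n ∈ range N', a n • G n)‖ ^ 2
    ≤ (C * ‖∑ n ∈ range N', a n • G n‖) ^ 2
  have e : ∀ n, u n (∑ k ∈ range N', a k • G k) = if n ∈ range N' then a n else 0 := by
    intro n
    rw [map_sum]
    simp only [map_smul, hu, smul_eq_mul, mul_ite, mul_one, mul_zero, Finset.sum_ite_eq]
  simp_rw [e]
  have h1 : ∑ n ∈ range N, ‖if n ∈ range N' then a n else 0‖ ^ 2
      ≤ ∑ n ∈ range N', ‖a n‖ ^ 2 := by
    have e2 : ∀ n, ‖if n ∈ range N' then a n else 0‖ ^ 2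
        = if n ∈ range N' then ‖a n‖ ^ 2 else 0 := by
      intro n; split_ifs <;> simp
    simp_rw [e2]
    rw [← Finset.sum_filter]
    refine Finset.sum_le_sum_of_subset_of_nonneg ?_ fun _ _ _ => by positivity
    intro n hn
    exact (Finset.mem_filter.1 hn).2
  refine h1.trans ?_
  have h2 := hlow (range N') a
  rw [inv_mul_le_iff₀ hC] at h2
  exact (Real.sqrt_le_left (by positivity)).1 h2

lemma evalR_continuous (g : C(↥(Set.Icc (-Real.pi) Real.pi), ℂ)) : Continuous (evalR g) :=
  g.continuous.comp continuous_projIcc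

lemma sup_bound (g : C(↥(Set.Icc (-Real.pi) Real.pi), ℂ)) (t c : ℝ) (hc : 0 ≤ c)
    (H : ∀ f : ℝ → ℂ, IntegrableOn f (Set.Icc (-Real.pi) Real.pi) →
      ‖∫ ω in Set.Icc (-Real.pi) Real.pi, f ω * (evalR g ω * Complex.exp (Complex.I * ω * t))‖
        ≤ c * ∫ ω in Set.Icc (-Real.pi) Real.pi, ‖f ω‖) : ‖g‖ ≤ c := by
  set w : ℝ → ℂ := fun ω => evalR g ω * Complex.exp (Complex.I * ω * t) with hw
  have hwc : Continuous w := (evalR_continuous g).mul (by fun_prop)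
  have hwn : ∀ ω, ‖w ω‖ = ‖evalR g ω‖ := by
    intro ω
    rw [hw]
    simp only [norm_mul]
    have : Complex.I * (ω : ℂ) * (t : ℂ) = ((ω * t : ℝ) : ℂ) * Complex.I := by push_cast; ring
    rw [this, Complex.norm_exp_ofReal_mul_I, mul_one]
  set m : ℝ → ℝ := fun ω => max (‖w ω‖ - c) 0 with hm
  have hmc : Continuous m := (hwc.norm.sub continuous_const).max continuous_const
  have hm0 : ∀ ω, 0 ≤ m ω := fun ω => le_max_right _ _
  have hI : ∀ {F : Type} [NormedAddCommGroup F] (q : ℝ → F), Continuous q →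
      IntegrableOn q (Set.Icc (-Real.pi) Real.pi) := fun q hq =>
    hq.continuousOn.integrableOn_compact isCompact_Icc
  have hfc : Continuous (fun ω => (starRingEnd ℂ) (w ω) * (m ω : ℂ)) :=
    (Complex.continuous_conj.comp hwc).mul (Complex.continuous_ofReal.comp hmc)
  have h1 := H (fun ω => (starRingEnd ℂ) (w ω) * (m ω : ℂ)) (hI _ hfc)
  have e1 : ∀ ω, (starRingEnd ℂ) (w ω) * (m ω : ℂ) * w ω = ((‖w ω‖ ^ 2 * m ω : ℝ) : ℂ) := by
    intro ω
    rw [mul_right_comm, mul_comm ((starRingEnd ℂ) (w ω)), Complex.mul_conj, Complex.normSq_eq_norm_sq]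
    push_cast; ring
  have e2 : ∀ ω, ‖(starRingEnd ℂ) (w ω) * (m ω : ℂ)‖ = ‖w ω‖ * m ω := by
    intro ω
    rw [norm_mul, RCLike.norm_conj, Complex.norm_real, Real.norm_of_nonneg (hm0 ω)]
  simp_rw [e2] at h1
  have e3 : ∫ ω in Set.Icc (-Real.pi) Real.pi, (starRingEnd ℂ) (w ω) * (m ω : ℂ) * w ω
      = ((∫ ω in Set.Icc (-Real.pi) Real.pi, ‖w ω‖ ^ 2 * m ω : ℝ) : ℂ) := by
    simp_rw [e1]; exact integral_ofReal
  change ‖∫ ω in Set.Icc (-Real.pi) Real.pi, (starRingEnd ℂ) (w ω) * (m ω : ℂ) * w ω‖ ≤ _ at h1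
  rw [e3, Complex.norm_real] at h1
  have h2 := (le_abs_self _).trans h1
  have c1 : Continuous fun ω => ‖w ω‖ ^ 2 * m ω := (hwc.norm.pow 2).mul hmc
  have c2 : Continuous fun ω => ‖w ω‖ * m ω := hwc.norm.mul hmc
  have c3 : Continuous fun ω => ‖w ω‖ * m ω ^ 2 := hwc.norm.mul (hmc.pow 2)
  have e4 : ∀ ω, ‖w ω‖ * m ω ^ 2 = ‖w ω‖ ^ 2 * m ω - c * (‖w ω‖ * m ω) := by
    intro ω
    rcases le_total (‖w ω‖ - c) 0 with h | h
    · have : m ω = 0 := max_eq_right h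
      rw [this]; ring
    · have : m ω = ‖w ω‖ - c := max_eq_left h
      rw [this]; ring
  have h3 : ∫ ω in Set.Icc (-Real.pi) Real.pi, ‖w ω‖ * m ω ^ 2 = 0 := by
    refine le_antisymm ?_ (integral_nonneg fun ω => mul_nonneg (norm_nonneg _) (sq_nonneg _))
    simp_rw [e4]
    rw [integral_sub (hI _ c1) ((hI _ c2).const_mul c), integral_const_mul]
    linarith
  rw [integral_eq_zero_iff_of_nonneg (fun ω => mul_nonneg (norm_nonneg _) (sq_nonneg _))
    (hI _ c3)] at h3
  have h4 := Measure.eqOn_Icc_of_ae_eq volume (by linarith [Real.pi_pos] : (-Real.pi) ≠ Real.pi)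
    h3 c3.continuousOn continuousOn_const
  rw [ContinuousMap.norm_le _ hc]
  intro x
  have h5 := h4 x.2
  have h6 : ‖w x‖ ≤ c := by
    by_contra hcon
    push Not at hcon
    have p1 : 0 < ‖w x‖ := hc.trans_lt hcon
    have p2 : 0 < m x := lt_max_of_lt_left (by linarith)
    have p3 : 0 < ‖w x‖ * m x ^ 2 := by positivity
    exact p3.ne' h5
  rw [hwn] at h6
  unfold evalR at h6
  rwa [Set.projIcc_val] at h6

lemma bs_L1 {Ω : Type*} [MeasurableSpace Ω] (ν : Measure Ω) (w : ℕ → Ω → ℂ)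
    (hw : ∀ N, Measurable (w N)) (b : ℕ → ℝ) (hb : ∀ N x, ‖w N x‖ ≤ b N)
    (H : ∀ f : Ω → ℂ, Integrable f ν → ∃ C, ∀ N, ‖∫ x, f x * w N x ∂ν‖ ≤ C) :
    ∃ C, 0 ≤ C ∧ ∀ N (f : Ω → ℂ), Integrable f ν →
      ‖∫ x, f x * w N x ∂ν‖ ≤ C * ∫ x, ‖f x‖ ∂ν := by
  have hi : ∀ N (f : Ω → ℂ), Integrable f ν → Integrable (fun x => f x * w N x) ν := fun N f hf =>
    hf.mul_bdd (c := b N) (hw N).aestronglyMeasurable (Eventually.of_forall (hb N))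
  let Λ : ℕ → Lp ℂ 1 ν →L[ℂ] ℂ := fun N => LinearMap.mkContinuous
    { toFun := fun f => ∫ x, f x * w N x ∂ν
      map_add' := by
        intro f g
        rw [← integral_add (hi N _ (L1.integrable_coeFn f)) (hi N _ (L1.integrable_coeFn g))]
        refine integral_congr_ae ?_
        filter_upwards [Lp.coeFn_add f g] with x hx
        rw [hx, Pi.add_apply, add_mul]
      map_smul' := by
        intro a f
        rw [RingHom.id_apply, smul_eq_mul, ← integral_const_mul]
        refine integral_congr_ae ?_
        filter_upwards [Lp.coeFn_smul a f] with x hx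
        rw [hx, Pi.smul_apply, smul_eq_mul, mul_assoc] }
    (b N) (by
      intro f
      change ‖∫ x, f x * w N x ∂ν‖ ≤ _
      rw [L1.norm_eq_integral_norm, ← integral_const_mul]
      refine norm_integral_le_of_norm_le ((L1.integrable_coeFn f).norm.const_mul _)
        (Eventually.of_forall fun x => ?_)
      rw [norm_mul, mul_comm]
      exact mul_le_mul_of_nonneg_right (hb N x) (norm_nonneg _))
  have hΛ : ∀ N f, Λ N f = ∫ x, f x * w N x ∂ν := fun N f => rfl
  obtain ⟨C, hC⟩ := banach_steinhaus (g := Λ) fun f => by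
    obtain ⟨C, hC⟩ := H f (L1.integrable_coeFn f)
    exact ⟨C, hC⟩
  refine ⟨C, (norm_nonneg _).trans (hC 0), fun N f hf => ?_⟩
  have h1 := (Λ N).le_of_opNorm_le (hC N) (hf.toL1 f)
  rw [hΛ, L1.norm_eq_integral_norm] at h1
  have e1 : ∫ x, hf.toL1 f x * w N x ∂ν = ∫ x, f x * w N x ∂ν := by
    refine integral_congr_ae ?_
    filter_upwards [hf.coeFn_toL1] with x hx
    rw [hx]
  have e2 : ∫ x, ‖hf.toL1 f x‖ ∂ν = ∫ x, ‖f x‖ ∂ν := by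
    refine integral_congr_ae ?_
    filter_upwards [hf.coeFn_toL1] with x hx
    rw [hx]
  rwa [e1, e2] at h1

lemma bounded_of_limsup (z : ℕ → ℂ) (h : limsup (fun N => (‖z N‖₊ : ENNReal)) atTop ≠ ⊤) :
    ∃ C, ∀ N, ‖z N‖ ≤ C := by
  obtain ⟨b, hb, hb'⟩ := ENNReal.lt_iff_exists_nnreal_btwn.1 (lt_top_iff_ne_top.2 h)
  have h1 := eventually_lt_of_limsup_lt hb
  have h2 : IsBoundedUnder (· ≤ ·) atTop fun N => ‖z N‖ := by
    refine ⟨b, ?_⟩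
    rw [eventually_map]
    filter_upwards [h1] with N hN
    exact_mod_cast (ENNReal.coe_lt_coe.1 hN).le
  obtain ⟨C, hC⟩ := h2.bddAbove_range
  exact ⟨C, fun N => hC ⟨N, rfl⟩⟩

lemma expCM_zero : expCM 0 = 1 := by
  ext ω
  simp [expCM]

lemma partial_sum_eq (G : ℕ → C(↥(Set.Icc (-Real.pi) Real.pi), ℂ))
    (u : ℕ → C(↥(Set.Icc (-Real.pi) Real.pi), ℂ) →L[ℂ] ℂ) (t : ℝ)
    (h : C(↥(Set.Icc (-Real.pi) Real.pi), ℂ)) (f : ℝ → ℂ)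
    (hf : IntegrableOn f (Set.Icc (-Real.pi) Real.pi)) (N : ℕ) :
    ∑ n ∈ Finset.range N, ((1 / (2 * Real.pi)) *
        ∫ ω in Set.Icc (-Real.pi) Real.pi,
          f ω * evalR (G n) ω * Complex.exp (Complex.I * ω * t)) * u n (h * expCM 0)
      = (1 / (2 * Real.pi)) * ∫ ω in Set.Icc (-Real.pi) Real.pi,
          f ω * (evalR (∑ n ∈ range N, u n h • G n) ω * Complex.exp (Complex.I * ω * t)) := by
  rw [expCM_zero, mul_one]
  have e : ∀ ω : ℝ, f ω * (evalR (∑ n ∈ range N, u n h • G n) ω * Complex.exp (Complex.I * ω * t))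
      = ∑ n ∈ range N, (f ω * evalR (G n) ω * Complex.exp (Complex.I * ω * t)) * u n h := by
    intro ω
    unfold evalR
    rw [ContinuousMap.sum_apply, Finset.sum_mul, Finset.mul_sum]
    refine Finset.sum_congr rfl fun n _ => ?_
    rw [ContinuousMap.smul_apply, smul_eq_mul]; ring
  simp_rw [e]
  rw [integral_finsetSum, Finset.mul_sum]
  · refine Finset.sum_congr rfl fun n _ => ?_
    rw [integral_mul_const]; ring
  · intro n _
    have hc : Continuous fun ω : ℝ => evalR (G n) ω * Complex.exp (Complex.I * ω * t) :=
      (evalR_continuous _).mul (by fun_prop)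
    have h1 : IntegrableOn (fun ω => f ω * (evalR (G n) ω * Complex.exp (Complex.I * ω * t)))
        (Set.Icc (-Real.pi) Real.pi) :=
      hf.mul_continuousOn hc.continuousOn isCompact_Icc
    have h2 := Integrable.mul_const h1 (u n h)
    simpa only [mul_assoc] using h2

end Helpers

/-- Theorem 89, first part: let `{ĝ_n} ⊂ C[-π,π]` be uniformly bounded
above and below in sup-norm, closed and minimal in `C[-π,π]`, with the lower `ℓ²` bound
(iii), and let `{u_n}` be the (unique) biorthogonal sequence of continuous linear
functionals. Then for every `t ∈ ℝ` there exist `ĥ_{*1} ∈ C[-π,π]` and a signal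
`f_{*1} ∈ PW¹_π` such that `limsup_N |∑_{n=1}^N c_n(f_{*1},t) w_n(ĥ_{*1},0)| = ∞`. -/
theorem stmt12 (G : ℕ → C(↥(Set.Icc (-Real.pi) Real.pi), ℂ))
    (hGbdd : ∃ B : ℝ, ∀ n, ‖G n‖ ≤ B)
    (hGlow : ∃ b : ℝ, 0 < b ∧ ∀ n, b ≤ ‖G n‖)
    (hGclosed : ∀ u : C(↥(Set.Icc (-Real.pi) Real.pi), ℂ), ∀ ε : ℝ, 0 < ε →
      ∃ (N : ℕ) (a : ℕ → ℂ), ‖u - ∑ n ∈ Finset.range N, a n • G n‖ < ε)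
    (hGmin : ∀ m : ℕ,
      G m ∉ closure (↑(Submodule.span ℂ (G '' {n | n ≠ m})) :
        Set C(↥(Set.Icc (-Real.pi) Real.pi), ℂ)))
    (C₁₃ : ℝ) (hC₁₃pos : 0 < C₁₃)
    (hC₁₃ : ∀ (s : Finset ℕ) (a : ℕ → ℂ),
      C₁₃⁻¹ * Real.sqrt (∑ n ∈ s, ‖a n‖ ^ 2) ≤ ‖∑ n ∈ s, a n • G n‖)
    (u : ℕ → C(↥(Set.Icc (-Real.pi) Real.pi), ℂ) →L[ℂ] ℂ)
    (hu : ∀ n m : ℕ, u n (G m) = if n = m then 1 else 0)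
    (t : ℝ) :
    ∃ hstar : C(↥(Set.Icc (-Real.pi) Real.pi), ℂ),
      ∃ fstarhat : ℝ → ℂ,
        IntegrableOn fstarhat (Set.Icc (-Real.pi) Real.pi) ∧
        Filter.limsup (fun N : ℕ =>
            (‖∑ n ∈ Finset.range N,
                ((1 / (2 * Real.pi)) *
                    ∫ ω in Set.Icc (-Real.pi) Real.pi,
                      fstarhat ω * evalR (G n) ω * Complex.exp (Complex.I * ω * t)) *
                u n (hstar * expCM 0)‖₊ : ENNReal))
          Filter.atTop = ⊤ := by
  by_contra hcon
  push Not at hcon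
  obtain ⟨B, hB⟩ := hGbdd
  let S : ℕ → C(↥(Set.Icc (-Real.pi) Real.pi), ℂ) →L[ℂ] C(↥(Set.Icc (-Real.pi) Real.pi), ℂ) :=
    fun N => ∑ n ∈ range N, (u n).smulRight (G n)
  have hS : ∀ N h, S N h = ∑ n ∈ range N, u n h • G n := by
    intro N h
    simp [S]
  obtain ⟨L, hL⟩ := banach_steinhaus (g := S) fun h => by
    have hbd : ∀ N (x : ℝ), ‖evalR (S N h) x * Complex.exp (Complex.I * x * t)‖ ≤ ‖S N h‖ := by
      intro N x
      have : Complex.I * (x : ℂ) * (t : ℂ) = ((x * t : ℝ) : ℂ) * Complex.I := by push_cast; ring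
      rw [norm_mul, this, Complex.norm_exp_ofReal_mul_I, mul_one]
      exact ContinuousMap.norm_coe_le_norm _ _
    obtain ⟨c, hc0, hc⟩ := bs_L1 (volume.restrict (Set.Icc (-Real.pi) Real.pi))
      (fun N x => evalR (S N h) x * Complex.exp (Complex.I * x * t))
      (fun N => ((evalR_continuous _).mul (by fun_prop)).measurable) (fun N => ‖S N h‖) hbd
      (by
        intro f hf
        obtain ⟨C, hC⟩ := bounded_of_limsup _ (hcon h f hf)
        refine ⟨2 * Real.pi * C, fun N => ?_⟩
        have h1 := hC N
        rw [partial_sum_eq G u t h f hf N, ← hS, norm_mul] at h1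
        have h2 : ‖(1 / (2 * (Real.pi : ℂ)))‖ = 1 / (2 * Real.pi) := by
          rw [norm_div, norm_mul, Complex.norm_real, Real.norm_of_nonneg Real.pi_pos.le]
          simp
        rw [h2, one_div, inv_mul_le_iff₀ (by positivity)] at h1
        exact h1)
    exact ⟨c, fun N => sup_bound (S N h) t c hc0 fun f hf => hc N f hf⟩
  refine no_basis G B hB u hu C₁₃ hC₁₃pos.le
    (bessel_of_lower G hGclosed C₁₃ hC₁₃pos hC₁₃ u hu) L fun N h => ?_
  rw [← hS]
  exact (S N).le_of_opNorm_le (hL N) h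
end
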